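/- arXiv:1611.09909 — 2 statements merged into one kernel-verified Lean document; each statement's English description precedes it below -/
import Mathlib

section
/- (Singular case, contribution of one-descent words.) Assume p₁ = 0 and p₂,…,pₙ ∈ D_Δ are distinct, nonzero, and (p₁,…,pₙ) satisfies the Bethe equations; assume Θ is differentiable. Fix 1 ≤ x₁ < … < xₙ ≤ N, x₀ = xₙ − N, and set Π_M = Π_{k=2}^n M(z_k). Let 𝒲₁ be the set of words w ∈ {L,M}^n having a unique cyclic index m with w_m w_{m+1} = ML. For ε ∉ {0,p₂,…,pₙ}, let T₁(ε) = Σ A_σ r_σ^ε(w) Z_σ^ε(w), the sum ranging over pairs (w,σ) with w ∈ 𝒲₁ and σ ∈ S_n satisfying σ(m) = 1 or σ(m+1) = 1 for the unique m with w_m w_{m+1} = ML, where r_σ^ε, Z_σ^ε are r_σ, Z_σ with p₁ replaced by ε. Then lim_{ε→0} T₁(ε) = c² Π_M (N + Σ_{k=2}^n ∂₁Θ(0,p_k)) ψ(x) − c²N Π_M Σ_{σ∈S_n : σ(n)=1} A_σ Π_{k=1}^n z_{σ(k)}^{x_k}, with ∂₁Θ the partial derivative of Θ in its first variable. -/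
open scoped BigOperators
open Complex

noncomputable section

/-- `S(x,y) = e^{-ix} + e^{iy} - 2*Delta`. -/
def Sfun (Δ x y : ℝ) : ℂ :=
  Complex.exp (-(Complex.I * (x : ℂ))) + Complex.exp (Complex.I * (y : ℂ)) - 2 * (Δ : ℂ)

/-- `μ`, the unique solution of `cos μ = -Δ` in `[0, π)` when `Δ ∈ [-1, 1)`, and `0` when `Δ < -1`. -/
def muD (Δ : ℝ) : ℝ := if -1 ≤ Δ then Real.arccos (-Δ) else 0

/-- `D_Δ = (-π + μ, π - μ)`. -/
def Ddom (Δ : ℝ) : Set ℝ := Set.Ioo (-Real.pi + muD Δ) (Real.pi - muD Δ)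

/-- `L(z) = 1 + c²z/(1-z)`. -/
def Lfun (c : ℝ) (z : ℂ) : ℂ := 1 + (c : ℂ) ^ 2 * z / (1 - z)

/-- `M(z) = 1 - c²/(1-z)`. -/
def Mfun (c : ℝ) (z : ℂ) : ℂ := 1 - (c : ℂ) ^ 2 / (1 - z)

/-- `z_j = e^{i p_j}`. -/
def zOf {n : ℕ} (p : Fin n → ℝ) : Fin n → ℂ := fun j => Complex.exp (Complex.I * (p j : ℂ))

/-- The coefficient `A_σ`. -/
def Acoef {n : ℕ} (Δ : ℝ) (p : Fin n → ℝ) (σ : Equiv.Perm (Fin n)) : ℂ :=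
  ((Equiv.Perm.sign σ : ℤ) : ℂ) *
    ∏ kl ∈ Finset.univ.filter (fun kl : Fin n × Fin n => kl.1 < kl.2),
      Complex.exp (Complex.I * (p (σ kl.1) : ℂ)) * Sfun Δ (p (σ kl.1)) (p (σ kl.2))

/-- `Z_σ(w)`; the letter `L` is encoded by `true` and the letter `M` by `false`. -/
def Zword {n : ℕ} (x : ℕ → ℤ) (z : Fin n → ℂ) (σ : Equiv.Perm (Fin n))
    (w : Fin n → Bool) : ℂ :=
  ∏ k : Fin n, if w k then z (σ k) ^ (x (k : ℕ)) else z (σ k) ^ (x ((k : ℕ) + 1))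

/-- `r_σ(w)`; the letter `L` is encoded by `true` and the letter `M` by `false`;
cyclic successor and predecessor of indices are given by `finRotate`. -/
def rword {n : ℕ} (c : ℝ) (z : Fin n → ℂ) (σ : Equiv.Perm (Fin n))
    (w : Fin n → Bool) : ℂ :=
  (∏ k : Fin n, if w k = false ∧ w (finRotate n k) = true then
      Mfun c (z (σ k)) * Lfun c (z (σ (finRotate n k))) - 1 else 1) *
  (∏ k : Fin n, if w ((finRotate n).symm k) = true ∧ w k = true then
      Lfun c (z (σ k)) else 1) *
  (∏ k : Fin n, if w k = false ∧ w (finRotate n k) = false then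
      Mfun c (z (σ k)) else 1)



namespace T1aux

/-- cyclic position `m + d`. -/
def pos {ν : ℕ} (m : Fin (ν + 2)) (d : ℕ) : Fin (ν + 2) :=
  ⟨(m.val + d) % (ν + 2), Nat.mod_lt _ (by omega)⟩

lemma rot_val {ν : ℕ} (k : Fin (ν + 2)) :
    (finRotate (ν + 2) k).val = (k.val + 1) % (ν + 2) := by
  rw [finRotate_apply, Fin.val_add]; rfl

lemma pos_zero {ν : ℕ} (m : Fin (ν + 2)) : pos m 0 = m := by
  apply Fin.ext; simp [pos, Nat.mod_eq_of_lt m.2]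

lemma rot_pos {ν : ℕ} (m : Fin (ν + 2)) (d : ℕ) :
    finRotate (ν + 2) (pos m d) = pos m (d + 1) := by
  apply Fin.ext; rw [rot_val]; simp [pos, add_assoc]

lemma pos_one {ν : ℕ} (m : Fin (ν + 2)) : pos m 1 = finRotate (ν + 2) m := by
  rw [← rot_pos, pos_zero]

lemma pos_full {ν : ℕ} (m : Fin (ν + 2)) : pos m (ν + 2) = m := by
  apply Fin.ext; simp [pos, Nat.mod_eq_of_lt m.2]

lemma pos_inj {ν : ℕ} {m : Fin (ν + 2)} {d e : ℕ} (hd : d < ν + 2) (he : e < ν + 2)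
    (h : pos m d = pos m e) : d = e := by
  have h1 : (m.val + d) ≡ (m.val + e) [MOD (ν + 2)] := congrArg Fin.val h
  exact (Nat.ModEq.add_left_cancel' _ h1).eq_of_lt_of_lt hd he

lemma pos_surj {ν : ℕ} (m k : Fin (ν + 2)) : ∃ d : Fin (ν + 2), pos m d.val = k := by
  have : Function.Injective (fun d : Fin (ν + 2) => pos m d.val) :=
    fun d e h => Fin.ext (pos_inj d.2 e.2 h)
  exact (Finite.injective_iff_surjective.1 this) k

lemma rot_ne {ν : ℕ} (m : Fin (ν + 2)) : finRotate (ν + 2) m ≠ m := by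
  intro h
  rw [← pos_one] at h
  nth_rewrite 2 [← pos_zero m] at h
  have := pos_inj (by omega) (by omega) h
  omega

/-- The word whose `L` letters are exactly at `m+1, …, m+d`. -/
def W {ν : ℕ} (m : Fin (ν + 2)) : ℕ → Fin (ν + 2) → Bool
  | 0 => fun _ => false
  | d + 1 => Function.update (W m d) (pos m (d + 1)) true

/-- The position permutation moving `m+1, …, m+d` back by one. -/
def R {ν : ℕ} (m : Fin (ν + 2)) : ℕ → Equiv.Perm (Fin (ν + 2))
  | 0 => 1
  | d + 1 => R m d * Equiv.swap (pos m d) (pos m (d + 1))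

lemma W_apply {ν : ℕ} (m : Fin (ν + 2)) {d i : ℕ} (hd : d < ν + 2) (hi : i < ν + 2) :
    W m d (pos m i) = true ↔ 1 ≤ i ∧ i ≤ d := by
  induction d with
  | zero => simp [W]; omega
  | succ d ih =>
    have ih := ih (by omega)
    simp only [W, Function.update_apply]
    by_cases h : i = d + 1
    · simp [h]
    · have : pos m i ≠ pos m (d + 1) := fun h' => h (pos_inj hi hd h')
      rw [if_neg this, ih]; omega

lemma R_apply_gt {ν : ℕ} (m : Fin (ν + 2)) {d i : ℕ} (hdi : d < i) (hi : i < ν + 2) :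
    R m d (pos m i) = pos m i := by
  induction d with
  | zero => simp [R]
  | succ d ih =>
    have ih := ih (by omega)
    simp only [R, Equiv.Perm.mul_apply]
    rw [Equiv.swap_apply_of_ne_of_ne, ih]
    · intro h; have := pos_inj (by omega) (by omega) h; omega
    · intro h; have := pos_inj (by omega) (by omega) h; omega

lemma R_apply_self {ν : ℕ} (m : Fin (ν + 2)) {d : ℕ} (hd : d < ν + 2) :
    R m d (pos m d) = m := by
  induction d with
  | zero => simp [R, pos_zero]
  | succ d ih =>
    have ih := ih (by omega)
    simp only [R, Equiv.Perm.mul_apply, Equiv.swap_apply_right, ih]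

lemma R_apply_base {ν : ℕ} (m : Fin (ν + 2)) {d : ℕ} (hd : d + 1 < ν + 2) :
    R m (d + 1) m = finRotate (ν + 2) m := by
  induction d with
  | zero =>
    simp only [R, Equiv.Perm.mul_apply, zero_add, pos_zero, Equiv.swap_apply_left, pos_one]
    simp
  | succ d ih =>
    have ih := ih (by omega)
    rw [R, Equiv.Perm.mul_apply, Equiv.swap_apply_of_ne_of_ne, ih]
    · intro h
      have := pos_inj (m := m) (d := 0) (by omega) (by omega) ((pos_zero m).trans h)
      omega
    · intro h
      have := pos_inj (m := m) (d := 0) (by omega) (by omega) ((pos_zero m).trans h)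
      omega

/-- descents -/
def Desc {ν : ℕ} (w : Fin (ν + 2) → Bool) (m : Fin (ν + 2)) : Prop :=
  w m = false ∧ w (finRotate (ν + 2) m) = true

lemma W_desc {ν : ℕ} (m : Fin (ν + 2)) {d : ℕ} (hd1 : 1 ≤ d) (hd : d < ν + 2) (k : Fin (ν + 2)) :
    Desc (W m d) k ↔ k = m := by
  obtain ⟨⟨i, hi⟩, rfl⟩ := pos_surj m k
  simp only [Desc]
  rw [rot_pos]
  have e0 := W_apply m hd hi
  have e0' : W m d (pos m i) = false ↔ ¬ (1 ≤ i ∧ i ≤ d) := by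
    rw [← e0]; simp
  rw [e0']
  have e2 : pos m i = m ↔ i = 0 := by
    constructor
    · intro h
      exact pos_inj hi (by omega) (h.trans (pos_zero m).symm)
    · rintro rfl; exact pos_zero m
  rw [e2]
  by_cases h : i + 1 < ν + 2
  · rw [W_apply m hd h]; omega
  · have : i + 1 = ν + 2 := by omega
    rw [this, pos_full]
    have := W_apply m hd (i := 0) (by omega)
    rw [pos_zero] at this
    rw [this]; omega

lemma W_inj {ν : ℕ} {m m' : Fin (ν + 2)} {d d' : ℕ} (hd1 : 1 ≤ d) (hd : d < ν + 2)
    (hd1' : 1 ≤ d') (hd' : d' < ν + 2) (h : W m d = W m' d') : m = m' ∧ d = d' := by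
  have h1 : m = m' := by
    rw [← W_desc m' hd1' hd', ← h, W_desc m hd1 hd]
  subst h1
  refine ⟨rfl, ?_⟩
  have a := W_apply m hd hd
  have b := W_apply m hd' hd
  have a' := W_apply m hd hd'
  have b' := W_apply m hd' hd'
  rw [h] at a a'
  have := b.symm.trans a
  have := b'.symm.trans a'
  omega

lemma W_exists {ν : ℕ} {w : Fin (ν + 2) → Bool} {m : Fin (ν + 2)} (hm : Desc w m)
    (hu : ∀ k, Desc w k → k = m) : ∃ d, 1 ≤ d ∧ d < ν + 2 ∧ w = W m d := by
  classical
  have hex : ∃ i, 1 ≤ i ∧ w (pos m i) = false := ⟨ν + 2, by omega, by rw [pos_full]; exact hm.1⟩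
  have h1 := Nat.find_spec hex
  have hmin := fun k => Nat.find_min hex (m := k)
  have hle : Nat.find hex ≤ ν + 2 := Nat.find_min' hex ⟨by omega, by rw [pos_full]; exact hm.1⟩
  generalize Nat.find hex = e at *
  have he1 : e ≠ 1 := by
    rintro rfl
    have := h1.2
    rw [pos_one, hm.2] at this
    cases this
  have hM : ∀ i, e ≤ i → i < ν + 2 → w (pos m i) = false := by
    intro i hi
    induction i, hi using Nat.le_induction with
    | base => intro _; exact h1.2
    | succ i hi ih =>
      intro hlt
      have ih := ih (by omega)
      by_contra hc
      have hc : w (pos m (i + 1)) = true := by simpa using hc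
      have := hu (pos m i) ⟨ih, by rw [rot_pos]; exact hc⟩
      have := pos_inj (m := m) (e := 0) (by omega) (by omega) (this.trans (pos_zero m).symm)
      omega
  refine ⟨e - 1, by omega, by omega, ?_⟩
  funext k
  obtain ⟨⟨i, hi⟩, rfl⟩ := pos_surj m k
  simp only
  rw [Bool.eq_iff_iff, W_apply m (by omega) hi]
  constructor
  · intro h
    have h0 : i ≠ 0 := by
      rintro rfl
      rw [pos_zero, hm.1] at h; cases h
    refine ⟨by omega, ?_⟩
    by_contra hc
    rw [hM i (by omega) hi] at h; cases h
  · rintro ⟨h2, h3⟩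
    have := hmin i (by omega)
    by_contra hc
    exact this ⟨h2, by simpa using hc⟩

/-- the sum over one-descent words as a sum over `(m,d)`. -/
lemma sum_words {ν : ℕ} (g : (Fin (ν + 2) → Bool) → ℂ)
    [DecidablePred fun w : Fin (ν + 2) → Bool => ∃! m, Desc w m] :
    (∑ w : Fin (ν + 2) → Bool, if ∃! m, Desc w m then g w else 0) =
      ∑ m : Fin (ν + 2), ∑ d ∈ Finset.univ.erase (0 : Fin (ν + 2)), g (W m d.val) := by
  classical
  rw [← Finset.sum_filter, ← Finset.sum_product', eq_comm]
  have hd : ∀ d : Fin (ν + 2), d ≠ 0 → 1 ≤ d.val := by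
    intro d hd
    have : d.val ≠ 0 := fun h => hd (Fin.ext h)
    omega
  refine Finset.sum_bij (fun a _ => W a.1 a.2.val) ?_ ?_ ?_ ?_
  · rintro ⟨m, d⟩ h
    simp only [Finset.mem_product, Finset.mem_univ, Finset.mem_erase, true_and, and_true] at h
    simp only [Finset.mem_filter, Finset.mem_univ, true_and]
    exact ⟨m, (W_desc m (hd d h) d.2 m).2 rfl, fun k hk => (W_desc m (hd d h) d.2 k).1 hk⟩
  · rintro ⟨m, d⟩ h ⟨m', d'⟩ h' he
    simp only [Finset.mem_product, Finset.mem_univ, Finset.mem_erase, true_and, and_true] at h h'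
    obtain ⟨h1, h2⟩ := W_inj (hd d h) d.2 (hd d' h') d'.2 he
    exact Prod.ext h1 (Fin.ext h2)
  · intro w hw
    simp only [Finset.mem_filter, Finset.mem_univ, true_and] at hw
    obtain ⟨m, hm, hu⟩ := hw
    obtain ⟨d, h1, h2, rfl⟩ := W_exists hm hu
    refine ⟨(m, ⟨d, h2⟩), ?_, rfl⟩
    simp only [Finset.mem_product, Finset.mem_univ, Finset.mem_erase, true_and, and_true]
    intro h
    have := congrArg Fin.val h
    simp at this; omega
  · intros; rfl


/-- product over ordered pairs under a permutation of the positions -/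
lemma pairs_comp {n : ℕ} (f : Fin n → Fin n → ℂ) (σ s : Equiv.Perm (Fin n)) :
    (∏ kl ∈ Finset.univ.filter (fun kl : Fin n × Fin n => kl.1 < kl.2),
      f ((σ * s) kl.1) ((σ * s) kl.2)) =
    ∏ kl ∈ Finset.univ.filter (fun kl : Fin n × Fin n => s⁻¹ kl.1 < s⁻¹ kl.2),
      f (σ kl.1) (σ kl.2) := by
  refine Finset.prod_bij (fun a _ => (s a.1, s a.2)) ?_ ?_ ?_ ?_
  · rintro ⟨k, l⟩ h
    simpa using h
  · rintro ⟨k, l⟩ _ ⟨k', l'⟩ _ h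
    simpa using h
  · rintro ⟨k, l⟩ h
    exact ⟨(s⁻¹ k, s⁻¹ l), by simpa using h, by simp⟩
  · rintro ⟨k, l⟩ h
    simp

lemma pairs_swap {n : ℕ} (f : Fin n → Fin n → ℂ) (σ : Equiv.Perm (Fin n)) (a b : Fin n)
    (hab : b.val = a.val + 1) :
    (∏ kl ∈ Finset.univ.filter (fun kl : Fin n × Fin n => kl.1 < kl.2),
      f ((σ * Equiv.swap a b) kl.1) ((σ * Equiv.swap a b) kl.2)) * f (σ a) (σ b) =
    (∏ kl ∈ Finset.univ.filter (fun kl : Fin n × Fin n => kl.1 < kl.2),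
      f (σ kl.1) (σ kl.2)) * f (σ b) (σ a) := by
  classical
  rw [pairs_comp, Equiv.swap_inv]
  have hne : a ≠ b := by intro h; rw [h] at hab; omega
  set C := Finset.univ.filter (fun kl : Fin n × Fin n => kl.1 < kl.2 ∧ kl ≠ (a, b)) with hC
  have h1 : Finset.univ.filter (fun kl : Fin n × Fin n => kl.1 < kl.2) = insert (a, b) C := by
    ext ⟨k, l⟩
    simp only [hC, Finset.mem_filter, Finset.mem_univ, true_and, Finset.mem_insert, Prod.mk.injEq,
      ne_eq]
    have : a < b := by rw [Fin.lt_def]; omega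
    constructor
    · intro h
      by_cases h' : k = a ∧ l = b
      · exact Or.inl h'
      · exact Or.inr ⟨h, h'⟩
    · rintro (⟨rfl, rfl⟩ | h)
      · exact this
      · exact h.1
  have h2 : Finset.univ.filter (fun kl : Fin n × Fin n =>
      Equiv.swap a b kl.1 < Equiv.swap a b kl.2) = insert (b, a) C := by
    ext ⟨k, l⟩
    simp only [hC, Finset.mem_filter, Finset.mem_univ, true_and, Finset.mem_insert, Prod.mk.injEq,
      ne_eq, Equiv.swap_apply_def, Fin.lt_def, Fin.ext_iff]
    split_ifs <;> omega
  have n1 : (a, b) ∉ C := by simp [hC]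
  have n2 : (b, a) ∉ C := by
    simp only [hC, Finset.mem_filter, Finset.mem_univ, true_and, Fin.lt_def]; omega
  rw [h1, h2, Finset.prod_insert n1, Finset.prod_insert n2]
  ring

lemma pairs_rot {ν : ℕ} (f : Fin (ν + 2) → Fin (ν + 2) → ℂ) (σ : Equiv.Perm (Fin (ν + 2))) :
    (∏ kl ∈ Finset.univ.filter (fun kl : Fin (ν + 2) × Fin (ν + 2) => kl.1 < kl.2),
      f ((σ * finRotate (ν + 2)) kl.1) ((σ * finRotate (ν + 2)) kl.2)) *
      ∏ b ∈ Finset.univ.erase (σ 0), f (σ 0) b =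
    (∏ kl ∈ Finset.univ.filter (fun kl : Fin (ν + 2) × Fin (ν + 2) => kl.1 < kl.2),
      f (σ kl.1) (σ kl.2)) * ∏ b ∈ Finset.univ.erase (σ 0), f b (σ 0) := by
  classical
  have key : ∀ k : Fin (ν + 2), ((finRotate (ν + 2))⁻¹ k).val =
      if k.val = 0 then ν + 1 else k.val - 1 := by
    intro k
    obtain ⟨j, rfl⟩ := (finRotate (ν + 2)).surjective k
    have hj : (finRotate (ν + 2))⁻¹ (finRotate (ν + 2) j) = j := (finRotate (ν + 2)).symm_apply_apply j
    rw [hj, rot_val]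
    have := j.2
    by_cases h : j.val + 1 < ν + 2
    · rw [Nat.mod_eq_of_lt h]; simp
    · have : j.val + 1 = ν + 2 := by omega
      rw [this]; simp; omega
  have himg : (Finset.univ.erase (σ 0)) = (Finset.univ.erase (0 : Fin (ν + 2))).image σ := by
    ext b
    simp only [Finset.mem_erase, Finset.mem_univ, and_true, Finset.mem_image]
    constructor
    · intro h
      refine ⟨σ⁻¹ b, ?_, by simp⟩
      intro h'
      apply h
      rw [← h']; simp
    · rintro ⟨a, ha, rfl⟩
      exact fun h => ha (σ.injective h)
  rw [pairs_comp, himg, Finset.prod_image (fun a _ b _ h => σ.injective h),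
    Finset.prod_image (fun a _ b _ h => σ.injective h)]
  set E := Finset.univ.erase (0 : Fin (ν + 2)) with hE
  set C := Finset.univ.filter
    (fun kl : Fin (ν + 2) × Fin (ν + 2) => kl.1 < kl.2 ∧ kl.1 ≠ 0) with hC
  have z0 : ∀ k : Fin (ν + 2), k = 0 ↔ k.val = 0 := fun k => by rw [Fin.ext_iff]; rfl
  have h1 : Finset.univ.filter (fun kl : Fin (ν + 2) × Fin (ν + 2) => kl.1 < kl.2) =
      C ∪ E.image (fun b => ((0 : Fin (ν + 2)), b)) := by
    ext ⟨k, l⟩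
    simp only [hC, hE, Finset.mem_filter, Finset.mem_univ, true_and, Finset.mem_union,
      Finset.mem_image, Finset.mem_erase, and_true, Prod.mk.injEq, ne_eq, exists_eq_right_right,
      Fin.lt_def, @eq_comm _ (0 : Fin (ν + 2)) k]
    simp only [z0]
    omega
  have h2 : Finset.univ.filter (fun kl : Fin (ν + 2) × Fin (ν + 2) =>
      (finRotate (ν + 2))⁻¹ kl.1 < (finRotate (ν + 2))⁻¹ kl.2) =
      C ∪ E.image (fun b => (b, (0 : Fin (ν + 2)))) := by
    ext ⟨k, l⟩
    simp only [hC, hE, Finset.mem_filter, Finset.mem_univ, true_and, Finset.mem_union,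
      Finset.mem_image, Finset.mem_erase, and_true, Prod.mk.injEq, ne_eq, 
      Fin.lt_def, key]
    have : (∃ a : Fin (ν + 2), ¬ a = 0 ∧ a = k ∧ 0 = l) ↔ (k.val ≠ 0 ∧ l.val = 0) := by
      constructor
      · rintro ⟨a, h1, rfl, rfl⟩
        exact ⟨fun h => h1 ((z0 a).2 h), rfl⟩
      · rintro ⟨h1, h2⟩
        exact ⟨k, fun h => h1 ((z0 k).1 h), rfl, ((z0 l).2 h2).symm⟩
    rw [this]
    simp only [z0]
    have := k.2
    have := l.2
    split_ifs <;> omega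
  have d1 : Disjoint C (E.image (fun b => ((0 : Fin (ν + 2)), b))) := by
    rw [Finset.disjoint_left]
    rintro ⟨k, l⟩ h h'
    simp only [hC, Finset.mem_filter, Finset.mem_image, Prod.mk.injEq] at h h'
    obtain ⟨a, _, h3, _⟩ := h'
    exact h.2.2 h3.symm
  have d2 : Disjoint C (E.image (fun b => (b, (0 : Fin (ν + 2))))) := by
    rw [Finset.disjoint_left]
    rintro ⟨k, l⟩ h h'
    simp only [hC, Finset.mem_filter, Finset.mem_image, Prod.mk.injEq] at h h'
    obtain ⟨a, _, _, h3⟩ := h'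
    have := h.2.1
    rw [← h3] at this
    exact absurd this (Fin.not_lt_zero _)
  rw [h1, h2, Finset.prod_union d1, Finset.prod_union d2,
    Finset.prod_image (by intro a _ b _ h; simpa using h),
    Finset.prod_image (by intro a _ b _ h; simpa using h)]
  ring


/-- The abstract data extracted from the Bethe equations. -/
structure Data (ν N : ℕ) (f : Fin (ν + 2) → Fin (ν + 2) → ℂ) (z L M : Fin (ν + 2) → ℂ)
    (A : Equiv.Perm (Fin (ν + 2)) → ℂ) : Prop where
  hA : ∀ σ, A σ = ((Equiv.Perm.sign σ : ℤ) : ℂ) *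
    ∏ kl ∈ Finset.univ.filter (fun kl : Fin (ν + 2) × Fin (ν + 2) => kl.1 < kl.2),
      f (σ kl.1) (σ kl.2)
  hf : ∀ a b, f a b ≠ 0
  hz : ∀ a, z a ≠ 0
  hz0 : z 0 = 1
  hBE : ∀ j, z j ^ N = (-1) ^ (ν + 1) * ∏ b ∈ Finset.univ.erase j, f j b / f b j
  hLM : ∀ j, j ≠ 0 → f 0 j * L j = -(f j 0 * M j)
  hL : ∀ j, j ≠ 0 → L j ≠ 0
  hM : ∀ j, j ≠ 0 → M j ≠ 0

variable {ν N : ℕ} {f : Fin (ν + 2) → Fin (ν + 2) → ℂ} {z L M : Fin (ν + 2) → ℂ}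
    {A : Equiv.Perm (Fin (ν + 2)) → ℂ}

lemma Data.adj (D : Data ν N f z L M A) (σ : Equiv.Perm (Fin (ν + 2))) (a b : Fin (ν + 2))
    (hab : b.val = a.val + 1) (ha : σ a = 0) :
    A σ * L (σ b) = A (σ * Equiv.swap a b) * M (σ b) := by
  have hne : a ≠ b := by intro h; rw [h] at hab; omega
  have hb : σ b ≠ 0 := by rw [← ha]; exact fun h => hne (σ.injective h).symm
  have h := pairs_swap f σ a b hab
  rw [D.hA, D.hA, Equiv.Perm.sign_mul, Equiv.Perm.sign_swap hne]
  generalize (∏ kl ∈ Finset.univ.filter (fun kl : Fin (ν + 2) × Fin (ν + 2) => kl.1 < kl.2),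
      f ((σ * Equiv.swap a b) kl.1) ((σ * Equiv.swap a b) kl.2)) = R' at *
  generalize (∏ kl ∈ Finset.univ.filter (fun kl : Fin (ν + 2) × Fin (ν + 2) => kl.1 < kl.2),
      f (σ kl.1) (σ kl.2)) = R at *
  rw [ha] at h
  have h3 := D.hLM _ hb
  apply mul_left_cancel₀ (D.hf (σ b) 0)
  push_cast
  linear_combination (-((Equiv.Perm.sign σ : ℤ) : ℂ) * L (σ b)) * h +
    ((Equiv.Perm.sign σ : ℤ) : ℂ) * R' * h3

lemma Data.rot (D : Data ν N f z L M A) (σ : Equiv.Perm (Fin (ν + 2))) :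
    A σ = z (σ 0) ^ N * A (σ * finRotate (ν + 2)) := by
  have h := pairs_rot f σ
  rw [D.hA, D.hA, Equiv.Perm.sign_mul, sign_finRotate, D.hBE, Finset.prod_div_distrib]
  generalize (∏ kl ∈ Finset.univ.filter (fun kl : Fin (ν + 2) × Fin (ν + 2) => kl.1 < kl.2),
      f ((σ * finRotate (ν + 2)) kl.1) ((σ * finRotate (ν + 2)) kl.2)) = R' at *
  generalize (∏ kl ∈ Finset.univ.filter (fun kl : Fin (ν + 2) × Fin (ν + 2) => kl.1 < kl.2),
      f (σ kl.1) (σ kl.2)) = R at *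
  have h1 : (∏ b ∈ Finset.univ.erase (σ 0), f b (σ 0)) ≠ 0 :=
    Finset.prod_ne_zero_iff.2 fun b _ => D.hf _ _
  have h2 : ((-1 : ℂ) ^ (ν + 1)) * (-1) ^ (ν + 1) = 1 := by
    rw [← mul_pow]; norm_num
  generalize (∏ b ∈ Finset.univ.erase (σ 0), f b (σ 0)) = P at *
  generalize (∏ b ∈ Finset.univ.erase (σ 0), f (σ 0) b) = Q at *
  push_cast
  field_simp
  have h3 : ((-1 : ℂ) ^ (ν + 1)) ^ 2 = 1 := by rw [sq, h2]
  linear_combination (-1 : ℂ) * h - Q * R' * h2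

lemma Data.wrap (D : Data ν N f z L M A) (σ : Equiv.Perm (Fin (ν + 2)))
    (ha : σ (Fin.last (ν + 1)) = 0) :
    A σ * L (σ 0) = z (σ 0) ^ N * A (σ * Equiv.swap (Fin.last (ν + 1)) 0) * M (σ 0) := by
  set t := finRotate (ν + 2) with ht
  have t1 : t (Fin.last (ν + 1)) = 0 := finRotate_last
  set a : Fin (ν + 2) := ⟨ν, by omega⟩ with hadef
  have t2 : t a = Fin.last (ν + 1) := by
    apply Fin.ext; rw [ht, rot_val]; simp [hadef]
  have e1 := D.rot σ
  have e2 := D.adj (σ * t) a (Fin.last (ν + 1)) (by simp [hadef])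
    (by rw [Equiv.Perm.mul_apply, t2, ha])
  rw [Equiv.Perm.mul_apply, t1] at e2
  have e3 := D.rot (σ * Equiv.swap (Fin.last (ν + 1)) 0)
  have e4 : σ * Equiv.swap (Fin.last (ν + 1)) 0 * t = σ * t * Equiv.swap a (Fin.last (ν + 1)) := by
    rw [mul_assoc, mul_assoc, ← t1]
    nth_rewrite 1 [← t2]
    rw [← Equiv.mul_swap_eq_swap_mul]
  rw [e4] at e3
  have e5 : (σ * Equiv.swap (Fin.last (ν + 1)) 0) 0 = 0 := by
    rw [Equiv.Perm.mul_apply, Equiv.swap_apply_right, ha]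
  rw [e5, D.hz0, one_pow, one_mul] at e3
  rw [e1, e3, mul_assoc, e2]
  ring

/-- the uniform cyclic exchange relation -/
lemma Data.rel (D : Data ν N f z L M A) (x : ℕ → ℤ) (hx0 : x 0 = x (ν + 2) - N)
    (σ : Equiv.Perm (Fin (ν + 2))) (q : Fin (ν + 2)) (hq : σ q = 0) :
    A σ * L (σ (finRotate (ν + 2) q)) *
      z (σ (finRotate (ν + 2) q)) ^ x (finRotate (ν + 2) q).val =
    A (σ * Equiv.swap q (finRotate (ν + 2) q)) * M (σ (finRotate (ν + 2) q)) *
      z (σ (finRotate (ν + 2) q)) ^ x (q.val + 1) := by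
  have hv := rot_val q
  by_cases h : q.val + 1 < ν + 2
  · rw [Nat.mod_eq_of_lt h] at hv
    rw [D.adj σ q _ hv hq, hv]
  · have hq1 : q = Fin.last (ν + 1) := by
      apply Fin.ext
      have := q.2
      rw [Fin.val_last]; omega
    subst hq1
    rw [finRotate_last, D.wrap σ hq]
    have hz := D.hz (σ 0)
    simp only [Fin.val_last, Fin.val_zero]
    have hx0' : x 0 = x (ν + 1 + 1) - N := hx0
    rw [hx0', zpow_sub₀ hz, zpow_natCast]
    field_simp

lemma prod_erase_perm (σ : Equiv.Perm (Fin (ν + 2))) (m : Fin (ν + 2)) (hm : σ m = 0)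
    (g : Fin (ν + 2) → ℂ) :
    ∏ k ∈ Finset.univ.erase m, g (σ k) = ∏ k ∈ Finset.univ.erase 0, g k := by
  refine Finset.prod_bij (fun a _ => σ a) ?_ ?_ ?_ ?_
  · intro a ha
    simp only [Finset.mem_erase, Finset.mem_univ, and_true] at ha ⊢
    rw [← hm]; exact fun h => ha (σ.injective h)
  · intro a _ b _ h; exact σ.injective h
  · intro b hb
    refine ⟨σ⁻¹ b, ?_, σ.apply_symm_apply b⟩
    simp only [Finset.mem_erase, Finset.mem_univ, and_true] at hb ⊢
    intro h
    apply hb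
    rw [← hm, ← h]; exact (σ.apply_symm_apply b).symm
  · intros; rfl

/-- key identity -/
lemma Data.key (D : Data ν N f z L M A) (x : ℕ → ℤ) (hx0 : x 0 = x (ν + 2) - N)
    (σ : Equiv.Perm (Fin (ν + 2))) (m : Fin (ν + 2)) (hm : σ m = 0) (d : ℕ) (hd : d < ν + 2) :
    A σ * ∏ k ∈ Finset.univ.erase m, (if W m d k then L (σ k) * z (σ k) ^ x k.val
        else M (σ k) * z (σ k) ^ x (k.val + 1)) =
    (∏ k ∈ Finset.univ.erase 0, M k) * (A (σ * R m d) *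
      ∏ k, z ((σ * R m d) k) ^ x (k.val + 1)) := by
  induction d with
  | zero =>
    simp only [W, R, mul_one, Bool.false_eq_true, if_false]
    rw [Finset.prod_mul_distrib, prod_erase_perm σ m hm M,
      ← Finset.mul_prod_erase Finset.univ (fun k => z (σ k) ^ x (k.val + 1)) (Finset.mem_univ m),
      hm, D.hz0, one_zpow]
    ring
  | succ d ih =>
    have ih := ih (by omega)
    set q := pos m d with hqdef
    set q' := pos m (d + 1) with hq'def
    have hrot : finRotate (ν + 2) q = q' := rot_pos m d
    set τ := σ * R m d with hτ
    have hτq : τ q = 0 := by rw [hτ, Equiv.Perm.mul_apply, R_apply_self m (by omega), hm]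
    have hτq' : τ q' = σ q' := by rw [hτ, Equiv.Perm.mul_apply, R_apply_gt m (by omega) hd]
    have hqq : q ≠ q' := by
      intro h; have := pos_inj (by omega) (by omega) h; omega
    have hmq : q' ≠ m := by
      intro h
      have := pos_inj (m := m) (e := 0) (by omega) (by omega) (h.trans (pos_zero m).symm)
      omega
    have hj : σ q' ≠ 0 := by rw [← hm]; exact fun h => hmq (σ.injective h)
    have hW : W m d q' = false := by
      by_contra h
      have h : W m d q' = true := by simpa using h
      rw [hq'def, W_apply m (by omega) hd] at h
      omega
    have hW' : W m (d + 1) q' = true := by rw [hq'def, W_apply m hd hd]; omega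
    have hrel := D.rel x hx0 τ q hτq
    rw [hrot, hτq'] at hrel
    have hR : σ * R m (d + 1) = τ * Equiv.swap q q' := by
      rw [hτ, mul_assoc]; rfl
    rw [hR]
    have hmem : q' ∈ Finset.univ.erase m := by simp [hmq]
    have hmem2 : q' ∈ Finset.univ.erase q := by simp [hqq.symm]
    rw [← Finset.mul_prod_erase _ _ hmem] at ih ⊢
    rw [← Finset.mul_prod_erase _ _ (Finset.mem_univ q), ← Finset.mul_prod_erase _ _ hmem2]
      at ih ⊢
    have c1 : ∏ k ∈ (Finset.univ.erase m).erase q', (if W m (d + 1) k then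
        L (σ k) * z (σ k) ^ x k.val else M (σ k) * z (σ k) ^ x (k.val + 1)) =
        ∏ k ∈ (Finset.univ.erase m).erase q', (if W m d k then
        L (σ k) * z (σ k) ^ x k.val else M (σ k) * z (σ k) ^ x (k.val + 1)) := by
      apply Finset.prod_congr rfl
      intro k hk
      have : k ≠ q' := (Finset.mem_erase.1 hk).1
      rw [W, Function.update_of_ne this]
    have c2 : ∏ k ∈ (Finset.univ.erase q).erase q',
        z ((τ * Equiv.swap q q') k) ^ x (k.val + 1) =
        ∏ k ∈ (Finset.univ.erase q).erase q', z (τ k) ^ x (k.val + 1) := by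
      apply Finset.prod_congr rfl
      intro k hk
      simp only [Finset.mem_erase, Finset.mem_univ, and_true] at hk
      rw [Equiv.Perm.mul_apply, Equiv.swap_apply_of_ne_of_ne hk.2 hk.1]
    have s1 : (τ * Equiv.swap q q') q = τ q' := by
      rw [Equiv.Perm.mul_apply, Equiv.swap_apply_left]
    have s2 : (τ * Equiv.swap q q') q' = τ q := by
      rw [Equiv.Perm.mul_apply, Equiv.swap_apply_right]
    rw [c1, c2, s1, s2, hτq, hτq', D.hz0, one_zpow, one_mul, if_pos hW']
    rw [hτq, hτq', D.hz0, one_zpow, one_mul, hW] at ih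
    simp only [Bool.false_eq_true, if_false] at ih
    generalize (∏ k ∈ (Finset.univ.erase m).erase q', (if W m d k then
        L (σ k) * z (σ k) ^ x k.val else M (σ k) * z (σ k) ^ x (k.val + 1))) = U at *
    generalize (∏ k ∈ (Finset.univ.erase q).erase q', z (τ k) ^ x (k.val + 1)) = V at *
    generalize (∏ k ∈ Finset.univ.erase 0, M k) = P at *
    have hMj := D.hM _ hj
    have hzj : z (σ q') ^ x (q'.val + 1) ≠ 0 := zpow_ne_zero _ (D.hz _)
    apply mul_left_cancel₀ (mul_ne_zero hMj hzj)
    linear_combination (L (σ q') * z (σ q') ^ x q'.val) * ih +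
      (P * V * z (σ q') ^ x (q'.val + 1)) * hrel


lemma lim_scalar (c : ℝ) (X Y : ℤ) :
    Filter.Tendsto (fun ζ : ℂ => Mfun c ζ * ζ ^ X + Lfun c ζ * ζ ^ Y)
      (nhdsWithin 1 {1}ᶜ) (nhds ((2 - (c : ℂ) ^ 2) + (c : ℂ) ^ 2 * ((X : ℂ) - Y))) := by
  have hd : HasDerivAt (fun ζ : ℂ => ζ ^ X - ζ ^ Y) ((X : ℂ) - Y) 1 := by
    have h1 := hasDerivAt_zpow X (1 : ℂ) (Or.inl one_ne_zero)
    have h2 := hasDerivAt_zpow Y (1 : ℂ) (Or.inl one_ne_zero)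
    have h3 := h1.fun_sub h2
    simp only [one_zpow, mul_one] at h3
    exact h3
  have hs := hasDerivAt_iff_tendsto_slope.1 hd
  have hX : Filter.Tendsto (fun ζ : ℂ => ζ ^ X) (nhdsWithin 1 {1}ᶜ) (nhds 1) := by
    have := (hasDerivAt_zpow X (1 : ℂ) (Or.inl one_ne_zero)).continuousAt.tendsto
    rw [one_zpow] at this
    exact this.mono_left nhdsWithin_le_nhds
  have hY : Filter.Tendsto (fun ζ : ℂ => ζ ^ Y) (nhdsWithin 1 {1}ᶜ) (nhds 1) := by
    have := (hasDerivAt_zpow Y (1 : ℂ) (Or.inl one_ne_zero)).continuousAt.tendsto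
    rw [one_zpow] at this
    exact this.mono_left nhdsWithin_le_nhds
  have hall := (hX.add (hY.const_mul (1 - (c : ℂ) ^ 2))).add (hs.const_mul ((c : ℂ) ^ 2))
  have e : (2 - (c : ℂ) ^ 2) + (c : ℂ) ^ 2 * ((X : ℂ) - Y) =
      1 + (1 - (c : ℂ) ^ 2) * 1 + (c : ℂ) ^ 2 * ((X : ℂ) - Y) := by ring
  rw [e]
  refine hall.congr' ?_
  filter_upwards [self_mem_nhdsWithin] with ζ hζ
  have h1 : ζ - 1 ≠ 0 := sub_ne_zero.2 hζ
  have h2 : 1 - ζ ≠ 0 := sub_ne_zero.2 (Ne.symm hζ)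
  simp only [slope_def_field, Mfun, Lfun, one_zpow, sub_self, sub_zero]
  have h3 : 1 - ζ = -(ζ - 1) := by ring
  rw [h3]
  field_simp
  ring

lemma rZ (c : ℝ) (x : ℕ → ℤ) (z : Fin (ν + 2) → ℂ) (σ : Equiv.Perm (Fin (ν + 2)))
    (w : Fin (ν + 2) → Bool) (m : Fin (ν + 2)) (hw : ∀ k, Desc w k ↔ k = m) :
    rword c z σ w * Zword x z σ w =
      (Mfun c (z (σ m)) * Lfun c (z (σ (finRotate (ν + 2) m))) - 1) *
        (z (σ m) ^ x (m.val + 1) *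
          z (σ (finRotate (ν + 2) m)) ^ x (finRotate (ν + 2) m).val) *
        ∏ k ∈ (Finset.univ.erase m).erase (finRotate (ν + 2) m),
          (if w k then Lfun c (z (σ k)) * z (σ k) ^ x k.val
            else Mfun c (z (σ k)) * z (σ k) ^ x (k.val + 1)) := by
  classical
  set t := finRotate (ν + 2) with ht
  have hwm := (hw m).2 rfl
  have hm1 : w m = false := hwm.1
  have hm2 : w (t m) = true := hwm.2
  have hne : t m ≠ m := rot_ne m
  have hmem : t m ∈ Finset.univ.erase m := by simp [hne]
  have p1 : (∏ k, if w k = false ∧ w (t k) = true then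
      Mfun c (z (σ k)) * Lfun c (z (σ (t k))) - 1 else 1) =
      Mfun c (z (σ m)) * Lfun c (z (σ (t m))) - 1 := by
    rw [Finset.prod_eq_single m]
    · rw [if_pos ⟨hm1, hm2⟩]
    · intro k _ hk
      rw [if_neg]
      intro h
      exact hk ((hw k).1 h)
    · simp
  have hw' : ∀ k, (w k = false ∧ w (t k) = true) ↔ k = m := hw
  unfold rword Zword
  rw [← ht]
  clear_value t
  rw [p1, mul_assoc, mul_assoc, mul_assoc, ← Finset.prod_mul_distrib, ← Finset.prod_mul_distrib]
  congr 1
  rw [← Finset.mul_prod_erase _ _ (Finset.mem_univ m), ← Finset.mul_prod_erase _ _ hmem, ← mul_assoc]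
  congr 1
  · congr 1
    · simp [hm1, hm2]
    · simp [hm1, hm2]
  · apply Finset.prod_congr rfl
    intro k hk
    simp only [Finset.mem_erase, Finset.mem_univ, and_true] at hk
    cases hk' : w k with
    | false =>
      have : w (t k) = false := by
        by_contra h
        exact hk.2 ((hw' k).1 ⟨hk', by simpa using h⟩)
      simp [this]
    | true =>
      have : w (t.symm k) = true := by
        by_contra h
        have h := (hw' (t.symm k)).1 ⟨by simpa using h, by simpa using hk'⟩
        apply hk.1
        rw [← h]; simp
      simp [this]

lemma Data.pair_lim {c : ℝ} (D : Data ν N f z (fun j => Lfun c (z j)) (fun j => Mfun c (z j)) A)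
    (x : ℕ → ℤ) (hx0 : x 0 = x (ν + 2) - N) (th : Fin (ν + 2) → ℂ)
    (hsum : ∀ j, j ≠ 0 → Lfun c (z j) + Mfun c (z j) = 2 - (c : ℂ) ^ 2)
    (hth : ∀ j, j ≠ 0 → (c : ℂ) ^ 2 * th j * (Lfun c (z j) * Mfun c (z j)) =
      (2 - (c : ℂ) ^ 2) * (Lfun c (z j) * Mfun c (z j) - 1))
    (σ : Equiv.Perm (Fin (ν + 2))) (m : Fin (ν + 2)) (hm : σ m = 0) (d : ℕ) (hd1 : 1 ≤ d)
    (hd : d < ν + 2) :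
    Filter.Tendsto (fun ζ : ℂ =>
        A σ * (rword c (Function.update z 0 ζ) σ (W m d) *
          Zword x (Function.update z 0 ζ) σ (W m d)) +
        A (σ * Equiv.swap m (finRotate (ν + 2) m)) *
          (rword c (Function.update z 0 ζ) (σ * Equiv.swap m (finRotate (ν + 2) m)) (W m d) *
          Zword x (Function.update z 0 ζ) (σ * Equiv.swap m (finRotate (ν + 2) m)) (W m d)))
      (nhdsWithin 1 {1}ᶜ)
      (nhds ((∏ k ∈ Finset.univ.erase 0, Mfun c (z k)) * (A (σ * R m d) *
        ∏ k, z ((σ * R m d) k) ^ x (k.val + 1)) *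
        ((c : ℂ) ^ 2 * th ((σ * R m d) m) +
          (c : ℂ) ^ 2 * ((x (m.val + 1) : ℂ) - (x (finRotate (ν + 2) m).val))))) := by
  classical
  have hRm : (σ * R m d) m = σ (finRotate (ν + 2) m) := by
    obtain ⟨e, rfl⟩ : ∃ e, d = e + 1 := ⟨d - 1, by omega⟩
    rw [Equiv.Perm.mul_apply, R_apply_base m hd]
  have hkey := D.key x hx0 σ m hm d hd
  have hrel := D.rel x hx0 σ m hm
  have hdesc := W_desc m hd1 hd
  set t := finRotate (ν + 2) with ht
  set σ' := σ * Equiv.swap m (t m) with hσ'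
  have hne : t m ≠ m := rot_ne m
  have hmem : t m ∈ Finset.univ.erase m := by simp [hne]
  have s1 : σ' m = σ (t m) := by rw [hσ', Equiv.Perm.mul_apply, Equiv.swap_apply_left]
  have s2 : σ' (t m) = 0 := by rw [hσ', Equiv.Perm.mul_apply, Equiv.swap_apply_right, hm]
  have hj : σ (t m) ≠ 0 := by rw [← hm]; exact fun h => hne (σ.injective h)
  have hWt : W m d (t m) = true := ((hdesc m).2 rfl).2
  rw [hRm, ← hkey, ← Finset.mul_prod_erase _ _ hmem, if_pos hWt]
  set C := ∏ k ∈ (Finset.univ.erase m).erase (t m),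
          (if W m d k then Lfun c (z (σ k)) * z (σ k) ^ x k.val
            else Mfun c (z (σ k)) * z (σ k) ^ x (k.val + 1)) with hC
  have c1 : ∀ ζ : ℂ, rword c (Function.update z 0 ζ) σ (W m d) *
          Zword x (Function.update z 0 ζ) σ (W m d) =
      (Mfun c ζ * Lfun c (z (σ (t m))) - 1) * (ζ ^ x (m.val + 1) *
        z (σ (t m)) ^ x (t m).val) * C := by
    intro ζ
    rw [rZ c x _ σ _ m hdesc, hm, Function.update_self, ← ht, Function.update_of_ne hj]
    congr 1
    apply Finset.prod_congr rfl
    intro k hk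
    simp only [Finset.mem_erase, Finset.mem_univ, and_true] at hk
    have : σ k ≠ 0 := by rw [← hm]; exact fun h => hk.2 (σ.injective h)
    rw [Function.update_of_ne this]
  have c2 : ∀ ζ : ℂ, rword c (Function.update z 0 ζ) σ' (W m d) *
          Zword x (Function.update z 0 ζ) σ' (W m d) =
      (Mfun c (z (σ (t m))) * Lfun c ζ - 1) * (z (σ (t m)) ^ x (m.val + 1) *
        ζ ^ x (t m).val) * C := by
    intro ζ
    rw [rZ c x _ σ' _ m hdesc, ← ht, s1, s2, Function.update_self, Function.update_of_ne hj]
    congr 1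
    apply Finset.prod_congr rfl
    intro k hk
    simp only [Finset.mem_erase, Finset.mem_univ, and_true] at hk
    have h3 : σ k ≠ 0 := by rw [← hm]; exact fun h => hk.2 (σ.injective h)
    have h4 : σ' k = σ k := by
      rw [hσ', Equiv.Perm.mul_apply, Equiv.swap_apply_of_ne_of_ne hk.2 hk.1]
    rw [h4, Function.update_of_ne h3]
  simp only [c1, c2]
  have hL := D.hL _ hj
  have hM := D.hM _ hj
  have hs := hsum _ hj
  have ht' := hth _ hj
  have hX : ∀ X : ℤ, Filter.Tendsto (fun ζ : ℂ => ζ ^ X) (nhdsWithin 1 {1}ᶜ) (nhds 1) := by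
    intro X
    have := (hasDerivAt_zpow X (1 : ℂ) (Or.inl one_ne_zero)).continuousAt.tendsto
    rw [one_zpow] at this
    exact this.mono_left nhdsWithin_le_nhds
  have l1 := lim_scalar c (x (m.val + 1)) (x (t m).val)
  have l2 := hX (x (m.val + 1))
  have l3 := hX (x (t m).val)
  generalize z (σ (t m)) ^ x (t m).val = u at *
  generalize z (σ (t m)) ^ x (m.val + 1) = v at *
  generalize Lfun c (z (σ (t m))) = Lj at *
  generalize Mfun c (z (σ (t m))) = Mj at *
  have hall := ((l1.const_mul (A σ * Lj * u * C)).sub (l2.const_mul (A σ * u * C))).sub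
    (l3.const_mul (A σ' * v * C))
  convert hall using 1
  · funext ζ
    linear_combination (-C * Lfun c ζ * ζ ^ x (t m).val) * hrel
  · congr 1
    apply mul_left_cancel₀ (mul_ne_zero hL hM)
    linear_combination (A σ * Lj * u * C) * ht' - Lj * C * hrel + A σ * Lj * u * C * hs

lemma sum_pairs (m : Fin (ν + 2)) (F : Equiv.Perm (Fin (ν + 2)) → ℂ) :
    (∑ σ : Equiv.Perm (Fin (ν + 2)),
      if σ m = 0 ∨ σ (finRotate (ν + 2) m) = 0 then F σ else 0) =
    ∑ σ ∈ Finset.univ.filter (fun σ : Equiv.Perm (Fin (ν + 2)) => σ m = 0),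
      (F σ + F (σ * Equiv.swap m (finRotate (ν + 2) m))) := by
  classical
  have hne := rot_ne m
  generalize finRotate (ν + 2) m = b at *
  rw [← Finset.sum_filter, Finset.filter_or, Finset.sum_union, Finset.sum_add_distrib]
  · congr 1
    symm
    refine Finset.sum_bij (fun σ _ => σ * Equiv.swap m b) ?_ ?_ ?_ ?_
    · intro σ hσ
      simp only [Finset.mem_filter, Finset.mem_univ, true_and] at hσ ⊢
      rw [Equiv.Perm.mul_apply, Equiv.swap_apply_right, hσ]
    · intro σ _ τ _ h
      exact mul_right_cancel h
    · intro σ hσ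
      simp only [Finset.mem_filter, Finset.mem_univ, true_and] at hσ
      refine ⟨σ * Equiv.swap m b, ?_, ?_⟩
      · simp only [Finset.mem_filter, Finset.mem_univ, true_and]
        rw [Equiv.Perm.mul_apply, Equiv.swap_apply_left, hσ]
      · rw [mul_assoc, Equiv.swap_mul_self, mul_one]
    · intros; rfl
  · rw [Finset.disjoint_left]
    intro σ h h'
    simp only [Finset.mem_filter, Finset.mem_univ, true_and] at h h'
    exact hne (σ.injective (h'.trans h.symm))

lemma sum_shift (m : Fin (ν + 2)) (V : Equiv.Perm (Fin (ν + 2)) → ℂ) :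
    (∑ d ∈ Finset.univ.erase (0 : Fin (ν + 2)),
      ∑ σ ∈ Finset.univ.filter (fun σ : Equiv.Perm (Fin (ν + 2)) => σ m = 0),
        V (σ * R m d.val)) = ∑ σ : Equiv.Perm (Fin (ν + 2)), if σ m = 0 then 0 else V σ := by
  classical
  have h1 : ∀ d : Fin (ν + 2),
      (∑ σ ∈ Finset.univ.filter (fun σ : Equiv.Perm (Fin (ν + 2)) => σ m = 0),
        V (σ * R m d.val)) =
      ∑ σ : Equiv.Perm (Fin (ν + 2)), if σ (pos m d.val) = 0 then V σ else 0 := by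
    intro d
    rw [← Finset.sum_filter]
    have hR := R_apply_self m d.2
    refine Finset.sum_bij (fun σ _ => σ * R m d.val) ?_ ?_ ?_ ?_
    · intro σ hσ
      simp only [Finset.mem_filter, Finset.mem_univ, true_and] at hσ ⊢
      rw [Equiv.Perm.mul_apply, hR, hσ]
    · intro σ _ τ _ h
      exact mul_right_cancel h
    · intro σ hσ
      simp only [Finset.mem_filter, Finset.mem_univ, true_and] at hσ
      refine ⟨σ * (R m d.val)⁻¹, ?_, by simp⟩
      simp only [Finset.mem_filter, Finset.mem_univ, true_and]
      have : (R m d.val)⁻¹ m = pos m d.val := by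
        nth_rewrite 2 [← hR]
        exact (R m d.val).symm_apply_apply _
      rw [Equiv.Perm.mul_apply, this, hσ]
    · intros; rfl
  rw [Finset.sum_congr rfl (fun d _ => h1 d), Finset.sum_comm]
  apply Finset.sum_congr rfl
  intro σ _
  obtain ⟨e, he⟩ := pos_surj m (σ⁻¹ 0)
  have hσe : σ (pos m e.val) = 0 := by rw [he]; exact σ.apply_symm_apply 0
  have huniq : ∀ d : Fin (ν + 2), σ (pos m d.val) = 0 → d = e := by
    intro d hd
    exact Fin.ext (pos_inj d.2 e.2 (σ.injective (hd.trans hσe.symm)))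
  by_cases h : σ m = 0
  · rw [if_pos h]
    apply Finset.sum_eq_zero
    intro d hd
    rw [if_neg]
    intro hd'
    have h0 : (0 : Fin (ν + 2)) = e := huniq 0 (by rw [Fin.val_zero, pos_zero]; exact h)
    rw [huniq d hd', ← h0] at hd
    simp at hd
  · rw [if_neg h, Finset.sum_eq_single e]
    · rw [if_pos hσe]
    · intro d _ hde
      rw [if_neg (fun hd' => hde (huniq d hd'))]
    · intro he'
      have : e = 0 := by simpa using he'
      rw [this, Fin.val_zero, pos_zero] at hσe
      exact absurd hσe h

lemma sum_final (P C K : ℂ) (th : Fin (ν + 2) → ℂ) (B : Equiv.Perm (Fin (ν + 2)) → ℂ)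
    (δ : Fin (ν + 2) → ℂ) (hδ : ∀ m, δ m = if m = Fin.last (ν + 1) then K else 0) :
    (∑ m : Fin (ν + 2), ∑ σ : Equiv.Perm (Fin (ν + 2)),
      if σ m = 0 then 0 else P * B σ * (C * th (σ m) + C * δ m)) =
    C * P * (K + ∑ k ∈ Finset.univ.erase 0, th k) * (∑ σ, B σ) -
      C * K * P * ∑ σ ∈ Finset.univ.filter
        (fun σ : Equiv.Perm (Fin (ν + 2)) => σ (Fin.last (ν + 1)) = 0), B σ := by
  classical
  rw [Finset.sum_comm, Finset.sum_filter, Finset.mul_sum, Finset.mul_sum, ← Finset.sum_sub_distrib]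
  apply Finset.sum_congr rfl
  intro σ _
  have h1 : ∀ m, (if σ m = 0 then 0 else P * B σ * (C * th (σ m) + C * δ m)) =
      P * B σ * C * (if σ m = 0 then 0 else th (σ m)) +
      P * B σ * C * (if m = Fin.last (ν + 1) then
        (if σ (Fin.last (ν + 1)) = 0 then 0 else K) else 0) := by
    intro m
    rw [hδ]
    by_cases h : m = Fin.last (ν + 1)
    · subst h
      by_cases h' : σ (Fin.last (ν + 1)) = 0
      · simp [h']
      · simp [h']; ring
    · by_cases h' : σ m = 0
      · simp [h, h']
      · simp [h, h']; ring
  rw [Finset.sum_congr rfl (fun m _ => h1 m), Finset.sum_add_distrib, ← Finset.mul_sum,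
    ← Finset.mul_sum, Equiv.sum_comp σ (fun k => if k = 0 then 0 else th k),
    Finset.sum_ite_eq' Finset.univ (Fin.last (ν + 1)), if_pos (Finset.mem_univ _)]
  have h2 : (∑ k : Fin (ν + 2), if k = 0 then 0 else th k) = ∑ k ∈ Finset.univ.erase 0, th k := by
    rw [← Finset.add_sum_erase _ _ (Finset.mem_univ 0), if_pos rfl, zero_add]
    apply Finset.sum_congr rfl
    intro k hk
    rw [if_neg (Finset.mem_erase.1 hk).1]
  rw [h2]
  split_ifs <;> ring

lemma Data.total {c : ℝ} (D : Data ν N f z (fun j => Lfun c (z j)) (fun j => Mfun c (z j)) A)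
    (x : ℕ → ℤ) (hx0 : x 0 = x (ν + 2) - N) (th : Fin (ν + 2) → ℂ)
    (hsum : ∀ j, j ≠ 0 → Lfun c (z j) + Mfun c (z j) = 2 - (c : ℂ) ^ 2)
    (hth : ∀ j, j ≠ 0 → (c : ℂ) ^ 2 * th j * (Lfun c (z j) * Mfun c (z j)) =
      (2 - (c : ℂ) ^ 2) * (Lfun c (z j) * Mfun c (z j) - 1)) :
    Filter.Tendsto (fun ζ : ℂ => ∑ m : Fin (ν + 2), ∑ d ∈ Finset.univ.erase (0 : Fin (ν + 2)),
        ∑ σ : Equiv.Perm (Fin (ν + 2)), if σ m = 0 ∨ σ (finRotate (ν + 2) m) = 0 then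
        A σ * (rword c (Function.update z 0 ζ) σ (W m d.val) *
          Zword x (Function.update z 0 ζ) σ (W m d.val)) else 0)
      (nhdsWithin 1 {1}ᶜ)
      (nhds ((c : ℂ) ^ 2 * (∏ k ∈ Finset.univ.erase 0, Mfun c (z k)) *
        ((N : ℂ) + ∑ k ∈ Finset.univ.erase 0, th k) *
          (∑ σ : Equiv.Perm (Fin (ν + 2)), A σ * ∏ k, z (σ k) ^ x (k.val + 1)) -
        (c : ℂ) ^ 2 * (N : ℂ) * (∏ k ∈ Finset.univ.erase 0, Mfun c (z k)) *
          ∑ σ ∈ Finset.univ.filter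
            (fun σ : Equiv.Perm (Fin (ν + 2)) => σ (Fin.last (ν + 1)) = 0),
            A σ * ∏ k, z (σ k) ^ x (k.val + 1))) := by
  classical
  rw [← sum_final (∏ k ∈ Finset.univ.erase 0, Mfun c (z k)) ((c : ℂ) ^ 2) (N : ℂ) th
    (fun σ => A σ * ∏ k, z (σ k) ^ x (k.val + 1))
    (fun m => ((x (m.val + 1) : ℂ) - (x (finRotate (ν + 2) m).val)))]
  · simp only [sum_pairs]
    apply tendsto_finsetSum
    intro m _
    rw [← sum_shift m (fun σ => (∏ k ∈ Finset.univ.erase 0, Mfun c (z k)) *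
      (A σ * ∏ k, z (σ k) ^ x (k.val + 1)) * ((c : ℂ) ^ 2 * th (σ m) +
        (c : ℂ) ^ 2 * ((x (m.val + 1) : ℂ) - (x (finRotate (ν + 2) m).val))))]
    apply tendsto_finsetSum
    intro d hd
    apply tendsto_finsetSum
    intro σ hσ
    have hd0 : d ≠ 0 := (Finset.mem_erase.1 hd).1
    have hd1 : d.val ≠ 0 := fun h => hd0 (Fin.ext h)
    exact D.pair_lim x hx0 th hsum hth σ m (Finset.mem_filter.1 hσ).2 d.val (by omega) d.2
  · intro m
    have hv := rot_val m
    by_cases h : m = Fin.last (ν + 1)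
    · subst h
      have hx0' : x 0 = x (ν + 1 + 1) - N := hx0
      rw [if_pos rfl, finRotate_last, Fin.val_zero, Fin.val_last, hx0']
      push_cast; ring
    · rw [if_neg h]
      have h1 : m.val + 1 < ν + 2 := by
        have := m.2
        have : m.val ≠ ν + 1 := fun h' => h (Fin.ext h')
        omega
      rw [hv, Nat.mod_eq_of_lt h1, sub_self]


lemma exp_ne_one {t : ℝ} (h0 : t ≠ 0) (h1 : -Real.pi < t) (h2 : t < Real.pi) :
    Complex.exp (Complex.I * (t : ℂ)) ≠ 1 := by
  intro h
  rw [Complex.exp_eq_one_iff] at h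
  obtain ⟨n, hn⟩ := h
  have hI : (t : ℂ) = (n : ℂ) * (2 * Real.pi) := by
    apply mul_left_cancel₀ Complex.I_ne_zero
    rw [hn]; ring
  have hr : t = (n : ℝ) * (2 * Real.pi) := by exact_mod_cast hI
  have hpi := Real.pi_pos
  have a1 : (n : ℝ) < 1 := by nlinarith
  have a2 : (-1 : ℝ) < n := by nlinarith
  have b1 : n < 1 := by exact_mod_cast a1
  have b2 : -1 < n := by exact_mod_cast a2
  have : n = 0 := by omega
  rw [this] at hr
  simp at hr
  exact h0 hr

lemma Ddom_sub {Δ t : ℝ} (h : t ∈ Ddom Δ) : -Real.pi < t ∧ t < Real.pi := by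
  have hm : 0 ≤ muD Δ := by
    unfold muD
    split_ifs
    · exact Real.arccos_nonneg _
    · exact le_refl _
  obtain ⟨h1, h2⟩ := h
  constructor <;> linarith

lemma theta_deriv {Δ : ℝ} {Θ : ℝ → ℝ → ℝ}
    (hΘ : ∀ a ∈ Ddom Δ, ∀ b ∈ Ddom Δ,
      Complex.exp (-(Complex.I * (Θ a b : ℂ))) =
        Complex.exp (Complex.I * ((a : ℂ) - (b : ℂ))) * Sfun Δ a b / Sfun Δ b a)
    (hΘdiff : ContDiffOn ℝ 1 (fun q : ℝ × ℝ => Θ q.1 q.2) (Ddom Δ ×ˢ Ddom Δ))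
    (hS : ∀ a ∈ Ddom Δ, ∀ b ∈ Ddom Δ, Sfun Δ a b ≠ 0)
    (h0 : (0 : ℝ) ∈ Ddom Δ) {b : ℝ} (hb : b ∈ Ddom Δ) :
    ((deriv (fun t => Θ t b) 0 : ℝ) : ℂ) * (Sfun Δ 0 b * Sfun Δ b 0) =
      Sfun Δ 0 b + Sfun Δ b 0 - Sfun Δ 0 b * Sfun Δ b 0 := by
  have hopen : IsOpen (Ddom Δ ×ˢ Ddom Δ) := isOpen_Ioo.prod isOpen_Ioo
  have hd : DifferentiableAt ℝ (fun q : ℝ × ℝ => Θ q.1 q.2) (0, b) :=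
    (hΘdiff.contDiffAt (hopen.mem_nhds ⟨h0, hb⟩)).differentiableAt (by norm_num)
  have hd2 : DifferentiableAt ℝ (fun t : ℝ => Θ t b) 0 := by
    have hg : DifferentiableAt ℝ (fun t : ℝ => ((t, b) : ℝ × ℝ)) 0 := by fun_prop
    exact DifferentiableAt.comp (0 : ℝ) (g := fun q : ℝ × ℝ => Θ q.1 q.2)
      (f := fun t : ℝ => ((t, b) : ℝ × ℝ)) hd hg
  have hg := hd2.hasDerivAt
  set g' := deriv (fun t => Θ t b) 0 with hg'
  have hgc : HasDerivAt (fun t : ℝ => ((Θ t b : ℝ) : ℂ)) (g' : ℂ) 0 := hg.ofReal_comp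
  have hid : HasDerivAt (fun t : ℝ => (t : ℂ)) 1 0 := by
    simpa using (hasDerivAt_id (0 : ℝ)).ofReal_comp
  have hE := ((hgc.const_mul Complex.I).fun_neg).cexp
  have hS1 : HasDerivAt (fun t : ℝ => Sfun Δ b t) (Complex.I) 0 := by
    have := (((hid.const_mul Complex.I).cexp).const_add
      (Complex.exp (-(Complex.I * (b : ℂ))))).sub_const (2 * (Δ : ℂ))
    simpa [Sfun] using this
  have hS0 : HasDerivAt (fun t : ℝ => Sfun Δ t b) (-Complex.I) 0 := by
    have := ((((hid.const_mul Complex.I).fun_neg).cexp).add_const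
      (Complex.exp (Complex.I * (b : ℂ)))).sub_const (2 * (Δ : ℂ))
    simpa [Sfun] using this
  have hX := (((hid.sub_const (b : ℂ)).const_mul Complex.I)).cexp
  have hl := hE.fun_mul hS1
  have hr := hX.fun_mul hS0
  have hev : (fun t : ℝ => Complex.exp (-(Complex.I * (Θ t b : ℂ))) * Sfun Δ b t) =ᶠ[nhds 0]
      (fun t : ℝ => Complex.exp (Complex.I * ((t : ℂ) - (b : ℂ))) * Sfun Δ t b) := by
    filter_upwards [isOpen_Ioo.mem_nhds h0] with t ht
    rw [hΘ t ht b hb, div_mul_cancel₀ _ (hS b hb t ht)]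
  have heq := (hl.congr_of_eventuallyEq hev.symm).unique hr
  have hval := hev.self_of_nhds
  simp only [Complex.ofReal_zero, zero_sub, mul_one] at heq hval
  have hz : Complex.exp (Complex.I * -(b : ℂ)) ≠ 0 := Complex.exp_ne_zero _
  generalize Complex.exp (Complex.I * -(b : ℂ)) = y at *
  generalize Complex.exp (-(Complex.I * (Θ 0 b : ℂ))) = E at *
  generalize Sfun Δ 0 b = S0 at *
  generalize Sfun Δ b 0 = S1 at *
  have hIne := Complex.I_ne_zero
  apply mul_left_cancel₀ (mul_ne_zero hIne hz)
  linear_combination (-S1) * heq + Complex.I * (1 - g' * S1) * hval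


lemma scalar_th {c z g S0 S1 : ℂ} (hz : z ≠ 0) (hz1 : z ≠ 1) (hS0 : S0 = z - 1 + c ^ 2)
    (hS1 : S1 * z = 1 - z + c ^ 2 * z) (hg : g * (S0 * S1) = S0 + S1 - S0 * S1) :
    c ^ 2 * g * ((1 + c ^ 2 * z / (1 - z)) * (1 - c ^ 2 / (1 - z))) =
      (2 - c ^ 2) * ((1 + c ^ 2 * z / (1 - z)) * (1 - c ^ 2 / (1 - z)) - 1) := by
  have h2 : 1 - z ≠ 0 := sub_ne_zero.2 (Ne.symm hz1)
  have hS1' : S1 = (1 - z + c ^ 2 * z) / z := by rw [← hS1]; field_simp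
  subst hS0
  rw [hS1'] at hg
  field_simp at hg
  field_simp
  linear_combination (-c ^ 2) * hg

lemma main_aux (ν N : ℕ)
    (c : ℝ) (Δ : ℝ) (hΔ : Δ = (2 - c ^ 2) / 2)
    (Θ : ℝ → ℝ → ℝ)
    (hΘ : ∀ a ∈ Ddom Δ, ∀ b ∈ Ddom Δ,
      Complex.exp (-(Complex.I * (Θ a b : ℂ))) =
        Complex.exp (Complex.I * ((a : ℂ) - (b : ℂ))) * Sfun Δ a b / Sfun Δ b a)
    (hΘdiff : ContDiffOn ℝ 1 (fun q : ℝ × ℝ => Θ q.1 q.2) (Ddom Δ ×ˢ Ddom Δ))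
    (p : Fin (ν + 2) → ℝ) (hpD : ∀ j, p j ∈ Ddom Δ)
    (hp0 : p 0 = 0)
    (hnonzero : ∀ j, j ≠ 0 → p j ≠ 0)
    (hBE : ∀ j, Complex.exp (Complex.I * (N : ℂ) * (p j : ℂ)) =
      (-1 : ℂ) ^ (ν + 1) *
        Complex.exp (-(Complex.I * ((∑ k, Θ (p j) (p k) : ℝ) : ℂ))))
    (x : ℕ → ℤ) (hx0 : x 0 = x (ν + 2) - N) :
    Filter.Tendsto
      (fun ε : ℝ => ∑ m : Fin (ν + 2), ∑ d ∈ Finset.univ.erase (0 : Fin (ν + 2)),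
        ∑ σ : Equiv.Perm (Fin (ν + 2)), if σ m = 0 ∨ σ (finRotate (ν + 2) m) = 0 then
        Acoef Δ p σ * (rword c (zOf (Function.update p 0 ε)) σ (W m d.val) *
          Zword x (zOf (Function.update p 0 ε)) σ (W m d.val)) else 0)
      (nhdsWithin 0 (Set.range p)ᶜ)
      (nhds ((c : ℂ) ^ 2 * (∏ k ∈ Finset.univ.erase 0, Mfun c (zOf p k)) *
        ((N : ℂ) + ((∑ k ∈ Finset.univ.erase 0, deriv (fun t => Θ t (p k)) 0 : ℝ) : ℂ)) *
          (∑ σ : Equiv.Perm (Fin (ν + 2)), Acoef Δ p σ * ∏ k, zOf p (σ k) ^ x (k.val + 1)) -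
        (c : ℂ) ^ 2 * (N : ℂ) * (∏ k ∈ Finset.univ.erase 0, Mfun c (zOf p k)) *
          ∑ σ ∈ Finset.univ.filter
            (fun σ : Equiv.Perm (Fin (ν + 2)) => σ (Fin.last (ν + 1)) = 0),
            Acoef Δ p σ * ∏ k, zOf p (σ k) ^ x (k.val + 1))) := by
  classical
  have hS : ∀ a ∈ Ddom Δ, ∀ b ∈ Ddom Δ, Sfun Δ a b ≠ 0 := by
    intro a ha b hb h
    have := hΘ a ha b hb
    rw [h] at this
    simp at this
  have h0D : (0 : ℝ) ∈ Ddom Δ := by rw [← hp0]; exact hpD 0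
  have hΔc : 2 * (Δ : ℂ) = 2 - (c : ℂ) ^ 2 := by rw [hΔ]; push_cast; ring
  have hzne : ∀ j, zOf p j ≠ 0 := fun j => Complex.exp_ne_zero _
  have hz1 : ∀ j, j ≠ 0 → zOf p j ≠ 1 := fun j hj =>
    exp_ne_one (hnonzero j hj) (Ddom_sub (hpD j)).1 (Ddom_sub (hpD j)).2
  have hz0 : zOf p 0 = 1 := by simp [zOf, hp0]
  have hS0 : ∀ j, Sfun Δ 0 (p j) = zOf p j - 1 + (c : ℂ) ^ 2 := by
    intro j
    simp only [Sfun, zOf, hΔc, Complex.ofReal_zero, mul_zero, neg_zero, Complex.exp_zero]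
    ring
  have hS1 : ∀ j, Sfun Δ (p j) 0 * zOf p j = 1 - zOf p j + (c : ℂ) ^ 2 * zOf p j := by
    intro j
    simp only [Sfun, zOf, hΔc, Complex.ofReal_zero, mul_zero, Complex.exp_zero, Complex.exp_neg]
    have := Complex.exp_ne_zero (Complex.I * (p j : ℂ))
    field_simp
    ring
  have hLv : ∀ j, j ≠ 0 → Lfun c (zOf p j) = Sfun Δ (p j) 0 * zOf p j / (1 - zOf p j) := by
    intro j hj
    have h2 : 1 - zOf p j ≠ 0 := sub_ne_zero.2 (Ne.symm (hz1 j hj))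
    rw [hS1, Lfun]; field_simp
  have hMv : ∀ j, j ≠ 0 → Mfun c (zOf p j) = -Sfun Δ 0 (p j) / (1 - zOf p j) := by
    intro j hj
    have h2 : 1 - zOf p j ≠ 0 := sub_ne_zero.2 (Ne.symm (hz1 j hj))
    rw [hS0, Mfun]; field_simp; ring
  have D : Data ν N (fun a b => Complex.exp (Complex.I * (p a : ℂ)) * Sfun Δ (p a) (p b)) (zOf p)
      (fun j => Lfun c (zOf p j)) (fun j => Mfun c (zOf p j)) (Acoef Δ p) := by
    refine ⟨fun σ => rfl, fun a b => mul_ne_zero (Complex.exp_ne_zero _) (hS _ (hpD a) _ (hpD b)),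
      hzne, hz0, ?_, ?_, ?_, ?_⟩
    · intro j
      have e1 : zOf p j ^ N = Complex.exp (Complex.I * (N : ℂ) * (p j : ℂ)) := by
        rw [zOf, ← Complex.exp_nat_mul]; congr 1; ring
      have e2 : Complex.exp (-(Complex.I * ((∑ k, Θ (p j) (p k) : ℝ) : ℂ))) =
          ∏ k, Complex.exp (-(Complex.I * (Θ (p j) (p k) : ℂ))) := by
        rw [← Complex.exp_sum, Complex.ofReal_sum, Finset.mul_sum, Finset.sum_neg_distrib]
      have e3 : ∀ k, Complex.exp (-(Complex.I * (Θ (p j) (p k) : ℂ))) =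
          Complex.exp (Complex.I * (p j : ℂ)) * Sfun Δ (p j) (p k) /
            (Complex.exp (Complex.I * (p k : ℂ)) * Sfun Δ (p k) (p j)) := by
        intro k
        rw [hΘ _ (hpD j) _ (hpD k), mul_sub, Complex.exp_sub]
        have := hS _ (hpD k) _ (hpD j)
        have := Complex.exp_ne_zero (Complex.I * (p k : ℂ))
        field_simp
      rw [e1, hBE, e2, ← Finset.mul_prod_erase _ _ (Finset.mem_univ j), e3 j, div_self, one_mul,
        Finset.prod_congr rfl (fun k _ => e3 k)]
      exact mul_ne_zero (Complex.exp_ne_zero _) (hS _ (hpD j) _ (hpD j))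
    · intro j hj
      have hzj : Complex.exp (Complex.I * (p j : ℂ)) = zOf p j := rfl
      rw [hLv j hj, hMv j hj, hp0, hzj]
      simp only [Complex.ofReal_zero, mul_zero, Complex.exp_zero]
      ring
    · intro j hj
      have h2 : 1 - zOf p j ≠ 0 := sub_ne_zero.2 (Ne.symm (hz1 j hj))
      rw [hLv j hj]
      exact div_ne_zero (mul_ne_zero (hS _ (hpD j) _ h0D) (hzne j)) h2
    · intro j hj
      have h2 : 1 - zOf p j ≠ 0 := sub_ne_zero.2 (Ne.symm (hz1 j hj))
      rw [hMv j hj]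
      exact div_ne_zero (neg_ne_zero.2 (hS _ h0D _ (hpD j))) h2
  have T := D.total x hx0 (fun k => ((deriv (fun t => Θ t (p k)) 0 : ℝ) : ℂ)) ?_ ?_
  · have hupd : ∀ ε : ℝ, zOf (Function.update p 0 ε) =
        Function.update (zOf p) 0 (Complex.exp (Complex.I * (ε : ℂ))) := by
      intro ε
      funext j
      by_cases h : j = 0
      · subst h; simp [zOf]
      · simp [zOf, h]
    simp only [hupd]
    have hζ : Filter.Tendsto (fun ε : ℝ => Complex.exp (Complex.I * (ε : ℂ)))
        (nhdsWithin 0 (Set.range p)ᶜ) (nhdsWithin 1 {1}ᶜ) := by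
      apply tendsto_nhdsWithin_iff.2
      constructor
      · have hcont : Continuous (fun ε : ℝ => Complex.exp (Complex.I * (ε : ℂ))) := by fun_prop
        have := hcont.tendsto 0
        simp only [Complex.ofReal_zero, mul_zero, Complex.exp_zero] at this
        exact this.mono_left nhdsWithin_le_nhds
      · have hI : Set.Ioo (-Real.pi) Real.pi ∈ nhdsWithin (0 : ℝ) (Set.range p)ᶜ :=
          mem_nhdsWithin_of_mem_nhds (isOpen_Ioo.mem_nhds
            ⟨by linarith [Real.pi_pos], Real.pi_pos⟩)
        filter_upwards [hI, self_mem_nhdsWithin] with ε h1 h2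
        have : ε ≠ 0 := fun h => h2 ⟨0, by rw [hp0, h]⟩
        exact exp_ne_one this h1.1 h1.2
    rw [Complex.ofReal_sum]
    exact T.comp hζ
  · intro j hj
    have h2 : 1 - zOf p j ≠ 0 := sub_ne_zero.2 (Ne.symm (hz1 j hj))
    simp only [Lfun, Mfun]
    field_simp
    ring
  · intro j hj
    exact scalar_th (hzne j) (hz1 j hj) (hS0 j) (hS1 j)
      (theta_deriv hΘ hΘdiff hS h0D (hpD j))

end T1aux

open scoped Classical in
/-- **Lemma 3.9: the limit of the contribution `T₁(ε)` of the one-descent words in the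
singular case `p₁ = 0`.** -/
theorem T1_limit_singular
    (N n : ℕ) (hN : 0 < N) (hn : 0 < n)
    (c : ℝ) (hc : 0 < c) (Δ : ℝ) (hΔ : Δ = (2 - c ^ 2) / 2)
    (Θ : ℝ → ℝ → ℝ)
    (hΘcont : ContinuousOn (fun q : ℝ × ℝ => Θ q.1 q.2) (Ddom Δ ×ˢ Ddom Δ))
    (hΘzero : Θ 0 0 = 0)
    (hΘ : ∀ a ∈ Ddom Δ, ∀ b ∈ Ddom Δ,
      Complex.exp (-(Complex.I * (Θ a b : ℂ))) =
        Complex.exp (Complex.I * ((a : ℂ) - (b : ℂ))) * Sfun Δ a b / Sfun Δ b a)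
    (hΘdiff : ContDiffOn ℝ 1 (fun q : ℝ × ℝ => Θ q.1 q.2) (Ddom Δ ×ˢ Ddom Δ))
    (p : Fin n → ℝ) (hpD : ∀ j, p j ∈ Ddom Δ)
    (hp0 : p ⟨0, hn⟩ = 0)
    (hdistinct : Function.Injective p)
    (hnonzero : ∀ j, j ≠ ⟨0, hn⟩ → p j ≠ 0)
    (hBE : ∀ j, Complex.exp (Complex.I * (N : ℂ) * (p j : ℂ)) =
      (-1 : ℂ) ^ (n - 1) *
        Complex.exp (-(Complex.I * ((∑ k, Θ (p j) (p k) : ℝ) : ℂ))))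
    (x : ℕ → ℤ) (hx0 : x 0 = x n - N)
    (hxmono : ∀ i j, i < j → j ≤ n → x i < x j)
    (hx1 : 1 ≤ x 1) (hxN : x n ≤ (N : ℤ))
    :
    Filter.Tendsto
      (fun ε : ℝ =>
        ∑ w : Fin n → Bool, ∑ σ : Equiv.Perm (Fin n),
          if (∃! m : Fin n, w m = false ∧ w (finRotate n m) = true) ∧
              (∃ m : Fin n, (w m = false ∧ w (finRotate n m) = true) ∧
                (σ m = ⟨0, hn⟩ ∨ σ (finRotate n m) = ⟨0, hn⟩)) then
            Acoef Δ p σ *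
              (rword c (zOf (Function.update p ⟨0, hn⟩ ε)) σ w *
                Zword x (zOf (Function.update p ⟨0, hn⟩ ε)) σ w)
          else 0)
      (nhdsWithin 0 (Set.range p)ᶜ)
      (nhds
        ((c : ℂ) ^ 2 *
            (∏ k ∈ Finset.univ.erase (⟨0, hn⟩ : Fin n), Mfun c (zOf p k)) *
            ((N : ℂ) +
              ((∑ k ∈ Finset.univ.erase (⟨0, hn⟩ : Fin n),
                  deriv (fun t => Θ t (p k)) 0 : ℝ) : ℂ)) *
            (∑ σ : Equiv.Perm (Fin n), Acoef Δ p σ *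
              ∏ k : Fin n, zOf p (σ k) ^ (x ((k : ℕ) + 1))) -
          (c : ℂ) ^ 2 * (N : ℂ) *
            (∏ k ∈ Finset.univ.erase (⟨0, hn⟩ : Fin n), Mfun c (zOf p k)) *
            ∑ σ ∈ Finset.univ.filter
                (fun σ : Equiv.Perm (Fin n) => σ ⟨n - 1, by omega⟩ = ⟨0, hn⟩),
              Acoef Δ p σ * ∏ k : Fin n, zOf p (σ k) ^ (x ((k : ℕ) + 1)))) := by
  obtain _ | _ | ν := n
  · omega
  · have hsub : Subsingleton (Fin (0 + 1)) := inferInstanceAs (Subsingleton (Fin 1))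
    have hfun : ∀ w : Fin (0 + 1) → Bool,
        ¬ (∃! m : Fin (0 + 1), w m = false ∧ w (finRotate (0 + 1) m) = true) := by
      rintro w ⟨m, ⟨h1, h2⟩, _⟩
      have : finRotate (0 + 1) m = m := Subsingleton.elim _ _
      rw [this, h1] at h2
      cases h2
    have hσ : ∀ σ : Equiv.Perm (Fin (0 + 1)), σ ⟨0 + 1 - 1, by omega⟩ = ⟨0, hn⟩ :=
      fun σ => Subsingleton.elim _ _
    have her : Finset.univ.erase (⟨0, hn⟩ : Fin (0 + 1)) = ∅ := by
      ext k
      simp only [Finset.mem_erase, Finset.mem_univ, and_true, Finset.notMem_empty, iff_false,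
        not_not]
      exact Subsingleton.elim _ _
    simp only [hfun, false_and, if_false, Finset.sum_const_zero, hσ, Finset.filter_true, her,
      Finset.prod_empty, Finset.sum_empty]
    convert tendsto_const_nhds using 2
    push_cast
    ring
  · have h := T1aux.main_aux ν N c Δ hΔ Θ hΘ hΘdiff p hpD hp0 hnonzero hBE x hx0
    refine Filter.Tendsto.congr ?_ h
    intro ε
    have hs := T1aux.sum_words (fun w => ∑ σ : Equiv.Perm (Fin (ν + 2)),
      if (∃ m : Fin (ν + 2), T1aux.Desc w m ∧
        (σ m = 0 ∨ σ (finRotate (ν + 2) m) = 0)) then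
        Acoef Δ p σ * (rword c (zOf (Function.update p 0 ε)) σ w *
          Zword x (zOf (Function.update p 0 ε)) σ w) else 0)
    have h1 : ∀ m : Fin (ν + 2), ∀ d ∈ Finset.univ.erase (0 : Fin (ν + 2)),
        ∀ σ : Equiv.Perm (Fin (ν + 2)),
        (∃ m' : Fin (ν + 2), T1aux.Desc (T1aux.W m d.val) m' ∧
          (σ m' = 0 ∨ σ (finRotate (ν + 2) m') = 0)) ↔
        (σ m = 0 ∨ σ (finRotate (ν + 2) m) = 0) := by
      intro m d hd σ
      have hd0 : d ≠ 0 := (Finset.mem_erase.1 hd).1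
      have hd1 : d.val ≠ 0 := fun h => hd0 (Fin.ext h)
      have hW := T1aux.W_desc m (d := d.val) (by omega) d.2
      constructor
      · rintro ⟨m', hm', h'⟩
        rw [(hW m').1 hm'] at h'
        exact h'
      · intro h'
        exact ⟨m, (hW m).2 rfl, h'⟩
    refine Eq.trans ?_ (hs.symm.trans ?_)
    · refine Finset.sum_congr rfl fun m _ => Finset.sum_congr rfl fun d hd =>
        Finset.sum_congr rfl fun σ _ => ?_
      exact if_congr (h1 m d hd σ).symm rfl rfl
    · refine Finset.sum_congr rfl fun w _ => ?_
      by_cases hw : ∃! m, T1aux.Desc w m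
      · rw [if_pos hw]
        refine Finset.sum_congr rfl fun σ _ => ?_
        refine if_congr ?_ rfl rfl
        exact ⟨fun h' => ⟨hw, h'⟩, fun h' => h'.2⟩
      · rw [if_neg hw]
        symm
        refine Finset.sum_eq_zero fun σ _ => ?_
        exact if_neg fun h' => hw h'.1
end
end

section
/- For every positive integer N, every c > 0 and Δ = (2 − c²)/2, the transfer matrix V of the six-vertex model and the XXZ Hamiltonian H commute: VH = HV. -/
open scoped BigOperators
open Complex

noncomputable section

/-- Positions (in `{1, …, N}`) of a subset of `Fin N`, in increasing order. -/
def posList {N : ℕ} (A : Finset (Fin N)) : List ℕ :=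
  (A.sort (· ≤ ·)).map (fun i => (i : ℕ) + 1)

/-- `a₁ ≤ b₁ ≤ a₂ ≤ b₂ ≤ … ≤ aₙ ≤ bₙ` for two lists of the same length. -/
def seqInterlace (a b : List ℕ) : Prop :=
  ∀ i, i < a.length →
    (a.getD i 0 ≤ b.getD i 0 ∧ (i + 1 < a.length → b.getD i 0 ≤ a.getD (i + 1) 0))

/-- Interlacement of two subsets of `{1, …, N}`. -/
def Interlaced {N : ℕ} (A B : Finset (Fin N)) : Prop :=
  A.card = B.card ∧
    (seqInterlace (posList A) (posList B) ∨ seqInterlace (posList B) (posList A))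

/-- `P(Ψ_x, Ψ_y)`, the number of positions at which `Ψ_x` and `Ψ_y` differ. -/
def Pdiff {N : ℕ} (A B : Finset (Fin N)) : ℕ := (symmDiff A B).card

open scoped Classical in
/-- The transfer matrix `V` of the six-vertex model (case `a = b = 1`). -/
def transferV (N : ℕ) (c : ℝ) : Matrix (Finset (Fin N)) (Finset (Fin N)) ℂ :=
  Matrix.of fun A B =>
    if A = B then 2 else if Interlaced A B then (c : ℂ) ^ (Pdiff A B) else 0

open scoped Classical in
/-- The summand `H_i` of the XXZ Hamiltonian. -/
def HXi (N : ℕ) [NeZero N] (Δ : ℝ) (i : Fin N) :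
    Matrix (Finset (Fin N)) (Finset (Fin N)) ℂ :=
  Matrix.of fun A B =>
    if A = B then (if ((i ∈ A) ↔ ((i + 1) ∈ A)) then (Δ : ℂ) / 2 else -((Δ : ℂ) / 2))
    else if (¬ ((i ∈ A) ↔ ((i + 1) ∈ A))) ∧ B = A.image (Equiv.swap i (i + 1)) then 1
    else 0

/-- The XXZ Hamiltonian `H = ∑_i H_i`. -/
def HX (N : ℕ) [NeZero N] (Δ : ℝ) : Matrix (Finset (Fin N)) (Finset (Fin N)) ℂ :=
  ∑ i : Fin N, HXi N Δ i


section Aux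
open scoped Fin.NatCast

/-- local vertex operator -/
def Lop (c : ℂ) (a b : Bool) : Matrix (Fin 2) (Fin 2) ℂ :=
  if a = b then 1 else if a then !![0, c; 0, 0] else !![0, 0; c, 0]

/-- local auxiliary operator -/
def Qop (c : ℂ) (a b : Bool) : Matrix (Fin 2) (Fin 2) ℂ :=
  if a = b then (if a then !![-(c^2/2), 0; 0, c^2/2] else !![c^2/2, 0; 0, -(c^2/2)]) else 0

/-- diagonal coefficient of the local Hamiltonian -/
def dco (D : ℂ) (a a' : Bool) : ℂ := if a = a' then D / 2 else -(D / 2)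

/-- off-diagonal coefficient of the local Hamiltonian -/
def oco (a a' : Bool) : ℂ := if a = a' then 0 else 1

theorem local_comm (c D : ℂ) (hD : D = (2 - c ^ 2) / 2) (a a' b b' : Bool) :
    dco D a a' • (Lop c a b * Lop c a' b') + oco a a' • (Lop c a' b * Lop c a b')
    - (dco D b b' • (Lop c a b * Lop c a' b') + oco b b' • (Lop c a b' * Lop c a' b))
    = Qop c a b * Lop c a' b' - Lop c a b * Qop c a' b' := by
  subst hD
  cases a <;> cases a' <;> cases b <;> cases b' <;>
    (ext i j; fin_cases i <;> fin_cases j <;>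
      simp [Lop, Qop, dco, oco, Matrix.mul_apply, Fin.sum_univ_two] <;> ring)

/-- trace of the product of local operators, started at position `i` -/
def TP {N : ℕ} [NeZero N] (F : Fin N → Matrix (Fin 2) (Fin 2) ℂ) (i : ℕ) : ℂ :=
  (((List.range N).map (fun k => F ((i + k : ℕ) : Fin N))).prod).trace

theorem TP_succ {N : ℕ} [NeZero N] (F : Fin N → Matrix (Fin 2) (Fin 2) ℂ) (i : ℕ) :
    TP F (i + 1) = TP F i := by
  obtain ⟨m, rfl⟩ : ∃ m, N = m + 1 := ⟨N - 1, by have := NeZero.pos N; omega⟩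
  unfold TP
  conv_lhs => rw [List.range_succ]
  conv_rhs => rw [List.range_succ_eq_map]
  simp only [List.map_append, List.map_cons, List.map_nil, List.prod_append, List.prod_cons,
    List.prod_nil, List.map_map, mul_one]
  rw [Matrix.trace_mul_comm]
  have h1 : ((i + 1 + m : ℕ) : Fin (m+1)) = ((i + 0 : ℕ) : Fin (m+1)) := by
    apply Fin.ext
    simp only [Fin.val_natCast]
    rw [show i + 1 + m = i + 0 + (m + 1) by ring, Nat.add_mod_right]
  rw [h1]
  congr 4
  funext k
  simp only [Function.comp]
  congr 2
  omega

theorem TP_zero {N : ℕ} [NeZero N] (F : Fin N → Matrix (Fin 2) (Fin 2) ℂ) (i : ℕ) :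
    TP F i = TP F 0 := by
  induction i with
  | zero => rfl
  | succ n ih => rw [TP_succ, ih]

/-- product over all sites but `i`, `i+1` -/
def Rest {m : ℕ} (F : Fin (m+2) → Matrix (Fin 2) (Fin 2) ℂ) (i : ℕ) :
    Matrix (Fin 2) (Fin 2) ℂ :=
  ((List.range m).map (fun k => F ((i + 2 + k : ℕ) : Fin (m+2)))).prod

theorem TP_split {m : ℕ} (F : Fin (m+2) → Matrix (Fin 2) (Fin 2) ℂ) (i : Fin (m+2)) :
    TP F 0 = (F i * F (i+1) * Rest F i).trace := by
  rw [← TP_zero F i]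
  unfold TP Rest
  rw [List.range_succ_eq_map, List.range_succ_eq_map]
  simp only [List.map_cons, List.prod_cons, List.map_map, mul_assoc]
  have h0 : ((i.val + 0 : ℕ) : Fin (m+2)) = i := by simp
  have h1 : ((i.val + Nat.succ 0 : ℕ) : Fin (m+2)) = i + 1 := by simp
  rw [h0, h1]
  congr 5
  funext k
  simp only [Function.comp]
  congr 2
  omega

theorem site_ne {m : ℕ} (i : Fin (m+2)) (k : ℕ) (hk : k < m) :
    ((i.val + 2 + k : ℕ) : Fin (m+2)) ≠ i ∧ ((i.val + 2 + k : ℕ) : Fin (m+2)) ≠ i + 1 := by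
  have hi := i.isLt
  constructor
  · intro h
    have h2 : (i.val + 2 + k) % (m+2) = i.val := by
      have := congrArg Fin.val h
      simpa only [Fin.val_natCast] using this
    rcases lt_or_ge (i.val + 2 + k) (m+2) with h3 | h3
    · rw [Nat.mod_eq_of_lt h3] at h2; omega
    · rw [Nat.mod_eq_sub_mod h3, Nat.mod_eq_of_lt (by omega)] at h2; omega
  · intro h
    have h2 : (i.val + 2 + k) % (m+2) = (i.val + 1) % (m+2) := by
      have := congrArg Fin.val h
      have e : i + 1 = ((i.val + 1 : ℕ) : Fin (m+2)) := by simp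
      rw [e] at this
      simpa only [Fin.val_natCast] using this
    have h4 : (1 + k) % (m+2) = 0 := by
      have : Nat.ModEq (m+2) (i.val + 1 + (1 + k)) (i.val + 1 + 0) := by
        unfold Nat.ModEq
        rw [show i.val + 1 + (1 + k) = i.val + 2 + k by ring]; exact h2
      have := Nat.ModEq.add_left_cancel' _ this
      simpa [Nat.ModEq] using this
    rw [Nat.mod_eq_of_lt (by omega)] at h4; omega

theorem Rest_congr {m : ℕ} (F G : Fin (m+2) → Matrix (Fin 2) (Fin 2) ℂ) (i : Fin (m+2))
    (h : ∀ j, j ≠ i → j ≠ i + 1 → F j = G j) : Rest F i = Rest G i := by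
  unfold Rest
  congr 1
  apply List.map_congr_left
  intro k hk
  have := site_ne i k (List.mem_range.1 hk)
  exact h _ this.1 this.2

/-- count of elements of `A` below `k` -/
def cnt {N : ℕ} (A : Finset (Fin N)) (k : ℕ) : ℕ := (A.filter (fun i => i.val < k)).card

theorem list_count (l : List ℕ) (hl : l.Pairwise (· < ·)) (k i : ℕ) (hi : i < l.length) :
    l.getD i 0 ≤ k ↔ i < l.countP (fun x => decide (x ≤ k)) := by
  induction l generalizing i with
  | nil => simp at hi
  | cons x l ih =>
    rw [List.pairwise_cons] at hl
    rw [List.countP_cons]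
    by_cases hx : x ≤ k
    · cases i with
      | zero => simp [hx]
      | succ j =>
        have := ih hl.2 j (by simpa using hi)
        simp [hx] at this ⊢
        exact this
    · have h0 : l.countP (fun x => decide (x ≤ k)) = 0 := by
        rw [List.countP_eq_zero]
        intro y hy
        have := hl.1 y hy
        simp; omega
      cases i with
      | zero => simp [hx, h0]
      | succ j =>
        have := ih hl.2 j (by simpa using hi)
        simp [hx, h0] at this ⊢
        exact this

theorem posList_eq {N : ℕ} (A : Finset (Fin N)) :
    posList A = (A.sort (· ≤ ·)).map (fun i : Fin N => (i : ℕ) + 1) := by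
  unfold posList
  have h : ∀ l : List (Fin N), (do let a ← l; pure (a : ℕ)) = l.map (fun a : Fin N => (a : ℕ)) := by
    intro l
    induction l with
    | nil => rfl
    | cons x l ih => simpa using ih
  rw [h, List.map_map]
  rfl

theorem posList_length {N : ℕ} (A : Finset (Fin N)) : (posList A).length = A.card := by
  simp [posList]

theorem posList_count {N : ℕ} (A : Finset (Fin N)) (k i : ℕ) (hi : i < A.card) :
    (posList A).getD i 0 ≤ k ↔ i < cnt A k := by
  rw [list_count]
  · have : (posList A).countP (fun x => decide (x ≤ k)) = cnt A k := by
      rw [posList_eq]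
      unfold cnt
      rw [List.countP_map]
      rw [Finset.card_filter, List.countP_eq_length_filter]
      have h1 : ∀ l : List (Fin N), (l.filter ((fun x => decide (x ≤ k)) ∘ (fun i : Fin N => (i:ℕ)+1))).length
          = (l.map (fun i : Fin N => if i.val < k then 1 else 0)).sum := by
        intro l
        induction l with
        | nil => simp
        | cons x l ih =>
          by_cases hx : x.val < k
          · simp [hx, Nat.succ_le_iff, ← ih, Function.comp_def]; omega
          · simp [hx, Nat.succ_le_iff, ← ih, Function.comp_def]
      rw [h1]
      conv_rhs => rw [← Finset.sort_toFinset (s := A) (r := (· ≤ ·))]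
      rw [List.sum_toFinset _ (Finset.sort_nodup _ _)]
    rw [this]
  · rw [posList_eq, List.pairwise_map]
    have := (Finset.sortedLT_sort A).pairwise
    refine this.imp ?_
    intro a b h
    have : a.val < b.val := h
    omega
  · rwa [posList_length]

theorem cnt_le {N : ℕ} (A : Finset (Fin N)) (k : ℕ) : cnt A k ≤ A.card :=
  Finset.card_filter_le _ _

theorem seqInterlace_iff {N : ℕ} (A B : Finset (Fin N)) (h : A.card = B.card) :
    seqInterlace (posList A) (posList B) ↔ ∀ k, cnt B k ≤ cnt A k ∧ cnt A k ≤ cnt B k + 1 := by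
  unfold seqInterlace
  rw [posList_length]
  constructor
  · intro H k
    have hA := cnt_le A k
    have hB := cnt_le B k
    constructor
    · by_contra hlt
      push Not at hlt
      have h1 := H (cnt B k - 1) (by omega)
      have h2 := (posList_count B k (cnt B k - 1) (by omega)).2 (by omega)
      have h3 := (posList_count A k (cnt B k - 1) (by omega)).1 (h1.1.trans h2)
      omega
    · by_contra hlt
      push Not at hlt
      have h1 := (H (cnt A k - 2) (by omega)).2 (by omega)
      have h2 := (posList_count A k (cnt A k - 2 + 1) (by omega)).2 (by omega)
      have h3 := (posList_count B k (cnt A k - 2) (by omega)).1 (h1.trans h2)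
      omega
  · intro H i hi
    constructor
    · rw [posList_count A _ i hi]
      have h2 := (posList_count B _ i (by omega)).1 (le_refl _)
      exact lt_of_lt_of_le h2 (H _).1
    · intro hi1
      rw [posList_count B _ i (by omega)]
      have h2 := (posList_count A _ (i+1) (by omega)).1 (le_refl _)
      have := (H ((posList A).getD (i + 1) 0)).2
      omega

/-- partial products -/
def Mp (c : ℂ) (a b : ℕ → Bool) : ℕ → Matrix (Fin 2) (Fin 2) ℂ
  | 0 => 1
  | n + 1 => Mp c a b n * Lop c (a n) (b n)

/-- height difference -/
def dh (a b : ℕ → Bool) : ℕ → ℤ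
  | 0 => 0
  | n + 1 => dh a b n + (if a n then 1 else 0) - (if b n then 1 else 0)

/-- number of differences -/
def pd (a b : ℕ → Bool) : ℕ → ℕ
  | 0 => 0
  | n + 1 => pd a b n + (if a n = b n then 0 else 1)

theorem Mp_row0 (c : ℂ) (a b : ℕ → Bool) (n : ℕ) :
    (Mp c a b n 0 0 = if (∀ k ≤ n, dh a b k = 0 ∨ dh a b k = 1) ∧ dh a b n = 0
      then c ^ pd a b n else 0) ∧
    (Mp c a b n 0 1 = if (∀ k ≤ n, dh a b k = 0 ∨ dh a b k = 1) ∧ dh a b n = 1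
      then c ^ pd a b n else 0) := by
  induction n with
  | zero => simp [Mp, dh, pd]
  | succ n ih =>
    have hs : (∀ k ≤ n + 1, dh a b k = 0 ∨ dh a b k = 1) ↔
      (∀ k ≤ n, dh a b k = 0 ∨ dh a b k = 1) ∧ (dh a b (n+1) = 0 ∨ dh a b (n+1) = 1) := by
      constructor
      · intro h; exact ⟨fun k hk => h k (by omega), h _ le_rfl⟩
      · rintro ⟨h, h'⟩ k hk
        rcases Nat.lt_or_ge n k with h1 | h1
        · rwa [show k = n + 1 by omega]
        · exact h k h1
    simp only [hs]
    by_cases hall : ∀ k ≤ n, dh a b k = 0 ∨ dh a b k = 1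
    · simp only [eq_true hall, true_and] at ih ⊢
      have hn := hall n le_rfl
      cases ha : a n <;> cases hb : b n <;> rcases hn with hn | hn <;>
        simp [Mp, dh, pd, Lop, ha, hb, hn, Matrix.mul_apply, Fin.sum_univ_two, ih, pow_succ]
    · simp only [eq_false hall, false_and, if_false] at ih ⊢
      simp [Mp, Matrix.mul_apply, Fin.sum_univ_two, ih]

theorem Mp_row1 (c : ℂ) (a b : ℕ → Bool) (n : ℕ) :
    (Mp c a b n 1 0 = if (∀ k ≤ n, dh a b k = 0 ∨ dh a b k = -1) ∧ dh a b n = -1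
      then c ^ pd a b n else 0) ∧
    (Mp c a b n 1 1 = if (∀ k ≤ n, dh a b k = 0 ∨ dh a b k = -1) ∧ dh a b n = 0
      then c ^ pd a b n else 0) := by
  induction n with
  | zero => simp [Mp, dh, pd]
  | succ n ih =>
    have hs : (∀ k ≤ n + 1, dh a b k = 0 ∨ dh a b k = -1) ↔
      (∀ k ≤ n, dh a b k = 0 ∨ dh a b k = -1) ∧ (dh a b (n+1) = 0 ∨ dh a b (n+1) = -1) := by
      constructor
      · intro h; exact ⟨fun k hk => h k (by omega), h _ le_rfl⟩
      · rintro ⟨h, h'⟩ k hk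
        rcases Nat.lt_or_ge n k with h1 | h1
        · rwa [show k = n + 1 by omega]
        · exact h k h1
    simp only [hs]
    by_cases hall : ∀ k ≤ n, dh a b k = 0 ∨ dh a b k = -1
    · simp only [eq_true hall, true_and] at ih ⊢
      have hn := hall n le_rfl
      cases ha : a n <;> cases hb : b n <;> rcases hn with hn | hn <;>
        simp [Mp, dh, pd, Lop, ha, hb, hn, Matrix.mul_apply, Fin.sum_univ_two, ih, pow_succ]
    · simp only [eq_false hall, false_and, if_false] at ih ⊢
      simp [Mp, Matrix.mul_apply, Fin.sum_univ_two, ih]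

/-- occupation numbers on ℕ -/
def occ {N : ℕ} [NeZero N] (A : Finset (Fin N)) (k : ℕ) : Bool := decide ((k : Fin N) ∈ A)

theorem cnt_succ {N : ℕ} [NeZero N] (A : Finset (Fin N)) (k : ℕ) (hk : k < N) :
    cnt A (k + 1) = cnt A k + (if occ A k then 1 else 0) := by
  unfold cnt occ
  have hv : ((k : Fin N)).val = k := by rw [Fin.val_natCast, Nat.mod_eq_of_lt hk]
  have key : A.filter (fun i => i.val < k + 1) =
      A.filter (fun i => i.val < k) ∪ A.filter (fun i => i = (k : Fin N)) := by
    ext i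
    simp only [Finset.mem_filter, Finset.mem_union, Fin.ext_iff, hv]
    constructor
    · rintro ⟨h, h'⟩
      rcases Nat.lt_or_ge i.val k with h1 | h1
      · exact Or.inl ⟨h, h1⟩
      · exact Or.inr ⟨h, by omega⟩
    · rintro (⟨h, h'⟩ | ⟨h, h'⟩) <;> exact ⟨h, by omega⟩
  rw [key, Finset.card_union_of_disjoint]
  · rw [Finset.filter_eq']
    by_cases h : (k : Fin N) ∈ A <;> simp [h]
  · rw [Finset.disjoint_left]
    intro i h1 h2
    simp only [Finset.mem_filter, Fin.ext_iff, hv] at h1 h2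
    omega

theorem dh_cnt {N : ℕ} [NeZero N] (A B : Finset (Fin N)) (k : ℕ) (hk : k ≤ N) :
    dh (occ A) (occ B) k = (cnt A k : ℤ) - cnt B k := by
  induction k with
  | zero => simp [dh, cnt]
  | succ k ih =>
    rw [dh, ih (by omega), cnt_succ A k (by omega), cnt_succ B k (by omega)]
    push_cast
    ring

theorem pd_cnt {N : ℕ} [NeZero N] (A B : Finset (Fin N)) (k : ℕ) (hk : k ≤ N) :
    pd (occ A) (occ B) k = cnt (symmDiff A B) k := by
  induction k with
  | zero => simp [pd, cnt]
  | succ k ih =>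
    rw [pd, ih (by omega), cnt_succ _ k (by omega)]
    congr 1
    simp only [occ, Finset.mem_symmDiff]
    by_cases h1 : (k : Fin N) ∈ A <;> by_cases h2 : (k : Fin N) ∈ B <;> simp [h1, h2]

theorem cnt_ge {N : ℕ} (A : Finset (Fin N)) (k : ℕ) (hk : N ≤ k) : cnt A k = A.card := by
  unfold cnt
  rw [Finset.filter_true_of_mem]
  intro i _
  exact lt_of_lt_of_le i.isLt hk

theorem eq_of_cnt {N : ℕ} [NeZero N] (A B : Finset (Fin N)) (h : ∀ k, cnt A k = cnt B k) :
    A = B := by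
  ext i
  have h1 := cnt_succ A i.val i.isLt
  have h2 := cnt_succ B i.val i.isLt
  rw [h, h, h2] at h1
  have h3 : occ A i.val = occ B i.val := by
    cases hA : occ A i.val <;> cases hB : occ B i.val <;> simp_all
  simpa [occ] using h3

theorem Mp_self (c : ℂ) (a : ℕ → Bool) (n : ℕ) : Mp c a a n = 1 := by
  induction n with
  | zero => rfl
  | succ n ih => simp [Mp, ih, Lop]

theorem Mp_eq_prod (c : ℂ) (a b : ℕ → Bool) (n : ℕ) :
    Mp c a b n = ((List.range n).map (fun k => Lop c (a k) (b k))).prod := by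
  induction n with
  | zero => rfl
  | succ n ih => rw [Mp, ih, List.range_succ]; simp

/-- local operators of a pair of configurations -/
def LL {N : ℕ} (c : ℂ) (A B : Finset (Fin N)) (j : Fin N) : Matrix (Fin 2) (Fin 2) ℂ :=
  Lop c (decide (j ∈ A)) (decide (j ∈ B))

theorem transferV_eq {N : ℕ} [NeZero N] (c : ℝ) (A B : Finset (Fin N)) :
    transferV N c A B = TP (LL (c : ℂ) A B) 0 := by
  classical
  have hTP : TP (LL (c : ℂ) A B) 0 = (Mp c (occ A) (occ B) N).trace := by
    rw [Mp_eq_prod]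
    simp [TP, LL, occ]
  rw [hTP]
  simp only [transferV, Matrix.of_apply]
  by_cases hAB : A = B
  · subst hAB
    simp [Mp_self]
  rw [if_neg hAB, Matrix.trace_fin_two, (Mp_row0 _ _ _ _).1, (Mp_row1 _ _ _ _).2,
    pd_cnt A B N le_rfl, cnt_ge _ _ le_rfl]
  have e0 : ((∀ k ≤ N, dh (occ A) (occ B) k = 0 ∨ dh (occ A) (occ B) k = 1) ∧
      dh (occ A) (occ B) N = 0) ↔ (A.card = B.card ∧ seqInterlace (posList A) (posList B)) := by
    rw [dh_cnt A B N le_rfl, cnt_ge _ _ le_rfl, cnt_ge _ _ le_rfl]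
    constructor
    · rintro ⟨h1, h2⟩
      have hc : A.card = B.card := by omega
      refine ⟨hc, ?_⟩
      rw [seqInterlace_iff A B hc]
      intro k
      rcases Nat.lt_or_ge N k with hk | hk
      · rw [cnt_ge A k hk.le, cnt_ge B k hk.le]; omega
      · have := h1 k hk
        rw [dh_cnt A B k hk] at this
        omega
    · rintro ⟨hc, h⟩
      rw [seqInterlace_iff A B hc] at h
      refine ⟨fun k hk => ?_, by omega⟩
      rw [dh_cnt A B k hk]
      have := h k
      omega
  have e1 : ((∀ k ≤ N, dh (occ A) (occ B) k = 0 ∨ dh (occ A) (occ B) k = -1) ∧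
      dh (occ A) (occ B) N = 0) ↔ (A.card = B.card ∧ seqInterlace (posList B) (posList A)) := by
    rw [dh_cnt A B N le_rfl, cnt_ge _ _ le_rfl, cnt_ge _ _ le_rfl]
    constructor
    · rintro ⟨h1, h2⟩
      have hc : A.card = B.card := by omega
      refine ⟨hc, ?_⟩
      rw [seqInterlace_iff B A hc.symm]
      intro k
      rcases Nat.lt_or_ge N k with hk | hk
      · rw [cnt_ge A k hk.le, cnt_ge B k hk.le]; omega
      · have := h1 k hk
        rw [dh_cnt A B k hk] at this
        omega
    · rintro ⟨hc, h⟩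
      rw [seqInterlace_iff B A hc.symm] at h
      refine ⟨fun k hk => ?_, by omega⟩
      rw [dh_cnt A B k hk]
      have := h k
      omega
  simp only [e0, e1, Interlaced, Pdiff]
  by_cases hc : A.card = B.card
  · by_cases h0 : seqInterlace (posList A) (posList B)
    · have h1 : ¬ seqInterlace (posList B) (posList A) := by
        intro h1
        rw [seqInterlace_iff A B hc] at h0
        rw [seqInterlace_iff B A hc.symm] at h1
        exact hAB (eq_of_cnt A B fun k => le_antisymm (h1 k).1 (h0 k).1)
      simp [hc, h0, h1]
    · by_cases h1 : seqInterlace (posList B) (posList A) <;> simp [hc, h0, h1]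
  · simp [hc]

theorem mem_swap {N : ℕ} (A : Finset (Fin N)) (i j k : Fin N) :
    k ∈ A.image (Equiv.swap i j) ↔ Equiv.swap i j k ∈ A := by
  rw [Finset.mem_image]
  constructor
  · rintro ⟨x, hx, rfl⟩; simpa using hx
  · intro h; exact ⟨_, h, by simp⟩

theorem HXi_apply {N : ℕ} [NeZero N] (Δ : ℝ) (i : Fin N) (A X : Finset (Fin N)) :
    HXi N Δ i A X = (if A = X then dco Δ (decide (i ∈ A)) (decide (i + 1 ∈ A)) else 0)
      + (if A.image (Equiv.swap i (i+1)) = X then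
          oco (decide (i ∈ A)) (decide (i + 1 ∈ A)) else 0) := by
  classical
  simp only [HXi, Matrix.of_apply]
  by_cases h : i ∈ A ↔ i + 1 ∈ A
  · simp [dco, oco, h]
  · have hne : A.image (Equiv.swap i (i+1)) ≠ A := by
      intro e
      apply h
      have := mem_swap A i (i+1) i
      rw [e] at this
      simpa using this
    by_cases hX : A = X
    · subst hX
      simp [dco, h, hne]
    · simp [oco, h, hX, eq_comm]

theorem HXi_symm {N : ℕ} [NeZero N] (Δ : ℝ) (i : Fin N) (A X : Finset (Fin N)) :
    HXi N Δ i A X = HXi N Δ i X A := by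
  have key : ∀ A X : Finset (Fin N), A.image (Equiv.swap i (i+1)) = X →
      X.image (Equiv.swap i (i+1)) = A := by
    rintro A X rfl
    ext k
    simp [mem_swap]
  rw [HXi_apply, HXi_apply]
  congr 1
  · by_cases h : A = X
    · subst h; rfl
    · rw [if_neg h, if_neg (Ne.symm h)]
  · by_cases h : A.image (Equiv.swap i (i+1)) = X
    · rw [if_pos h, if_pos (key _ _ h)]
      subst h
      simp only [mem_swap, Equiv.swap_apply_left, Equiv.swap_apply_right, oco, eq_comm]
    · rw [if_neg h, if_neg (fun h' => h (key _ _ h'))]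

theorem local_step {m : ℕ} (c Δ : ℝ) (hΔ : Δ = (2 - c ^ 2) / 2) (A B : Finset (Fin (m+2)))
    (i : Fin (m+2)) :
    (HXi (m+2) Δ i * transferV (m+2) c) A B - (transferV (m+2) c * HXi (m+2) Δ i) A B
    = TP (Function.update (LL (c:ℂ) A B) i (Qop c (decide (i ∈ A)) (decide (i ∈ B)))) 0
      - TP (Function.update (LL (c:ℂ) A B) (i+1)
          (Qop c (decide (i+1 ∈ A)) (decide (i+1 ∈ B)))) 0 := by
  have hD : (Δ : ℂ) = (2 - (c:ℂ) ^ 2) / 2 := by rw [hΔ]; push_cast; ring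
  have hne : i + 1 ≠ i := by simp
  rw [Matrix.mul_apply, Matrix.mul_apply]
  have e2 : ∀ X, transferV (m+2) c A X * HXi (m+2) Δ i X B =
      transferV (m+2) c A X * HXi (m+2) Δ i B X := fun X => by rw [HXi_symm]
  rw [Finset.sum_congr rfl (fun X _ => e2 X)]
  simp only [HXi_apply, add_mul, mul_add, ite_mul, mul_ite, zero_mul, mul_zero,
    Finset.sum_add_distrib, Finset.sum_ite_eq, Finset.mem_univ, if_true, transferV_eq]
  simp only [TP_split _ i]
  have r1 : Rest (LL (c:ℂ) (A.image (Equiv.swap i (i+1))) B) i = Rest (LL (c:ℂ) A B) i := by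
    apply Rest_congr
    intro j h1 h2
    simp only [LL, mem_swap, Equiv.swap_apply_of_ne_of_ne h1 h2]
  have r2 : Rest (LL (c:ℂ) A (B.image (Equiv.swap i (i+1)))) i = Rest (LL (c:ℂ) A B) i := by
    apply Rest_congr
    intro j h1 h2
    simp only [LL, mem_swap, Equiv.swap_apply_of_ne_of_ne h1 h2]
  have r3 : ∀ Q, Rest (Function.update (LL (c:ℂ) A B) i Q) i = Rest (LL (c:ℂ) A B) i := by
    intro Q
    apply Rest_congr
    intro j h1 h2
    rw [Function.update_of_ne h1]
  have r4 : ∀ Q, Rest (Function.update (LL (c:ℂ) A B) (i+1) Q) i = Rest (LL (c:ℂ) A B) i := by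
    intro Q
    apply Rest_congr
    intro j h1 h2
    rw [Function.update_of_ne h2]
  rw [r1, r2, r3, r4, Function.update_self, Function.update_self, Function.update_of_ne hne,
    Function.update_of_ne hne.symm, ← Matrix.trace_sub, ← sub_mul]
  simp only [LL, mem_swap, Equiv.swap_apply_left, Equiv.swap_apply_right]
  rw [← local_comm (c:ℂ) Δ hD]
  simp only [sub_mul, add_mul, smul_mul_assoc, Matrix.trace_sub, Matrix.trace_add,
    Matrix.trace_smul, smul_eq_mul]
  ring

end Aux

/-- **Lemma 5.1: the six-vertex transfer matrix and the XXZ Hamiltonian commute.** -/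
theorem transferV_commute_HX (N : ℕ) [NeZero N] (c : ℝ) (hc : 0 < c)
    (Δ : ℝ) (hΔ : Δ = (2 - c ^ 2) / 2) :
    transferV N c * HX N Δ = HX N Δ * transferV N c := by
  obtain ⟨n, rfl⟩ : ∃ m, N = m + 1 := ⟨N - 1, by have := NeZero.pos N; omega⟩
  cases n with
  | zero =>
    have : HX 1 Δ = ((Δ : ℂ) / 2) • (1 : Matrix (Finset (Fin 1)) (Finset (Fin 1)) ℂ) := by
      ext A B
      have h1 : ∀ i : Fin 1, i + 1 = i := fun i => Subsingleton.elim _ _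
      simp [HX, HXi, h1, Matrix.one_apply]
    have h2 := this
    simp only [Nat.zero_add, h2, Matrix.mul_smul, Matrix.smul_mul, mul_one, one_mul]
  | succ m =>
    ext A B
    symm
    rw [← sub_eq_zero]
    unfold HX
    rw [Finset.sum_mul, Finset.mul_sum, Matrix.sum_apply, Matrix.sum_apply,
      ← Finset.sum_sub_distrib]
    have := fun i => local_step c Δ hΔ A B i
    refine (Finset.sum_congr rfl fun i _ => this i).trans ?_
    rw [Finset.sum_sub_distrib, sub_eq_zero]
    exact (Equiv.sum_comp (Equiv.addRight (1 : Fin (m+2))) (fun i =>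
      TP (Function.update (LL (c:ℂ) A B) i (Qop c (decide (i ∈ A)) (decide (i ∈ B)))) 0)).symm
end
end
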